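/- arXiv:1504.04470 — 2 statements merged into one kernel-verified Lean document; each statement's English description precedes it below -/
import Mathlib

section
/- Every connected graph that contains no induced claw, tent S_3, net, C_4, or W_5 is a proper Helly circular-arc graph. -/
/-- A unit interval graph: vertices can be mapped to reals so that two distinct
vertices are adjacent iff their images are within distance 1. -/
def SimpleGraph.IsUnitIntervalGraph {V : Type*} (G : SimpleGraph V) : Prop :=
  ∃ f : V → ℝ, ∀ u v : V, u ≠ v → (G.Adj u v ↔ |f u - f v| ≤ 1)

/-- `f : ZMod n → V` describes a hole (induced cycle of length `n ≥ 4`) of `G`. -/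
def SimpleGraph.IsHoleOn {V : Type*} (G : SimpleGraph V) (n : ℕ) (f : ZMod n → V) : Prop :=
  4 ≤ n ∧ Function.Injective f ∧
    ∀ i j : ZMod n, (G.Adj (f i) (f j) ↔ (i = j + 1 ∨ j = i + 1))

def SimpleGraph.HasHole {V : Type*} (G : SimpleGraph V) : Prop :=
  ∃ (n : ℕ) (f : ZMod n → V), G.IsHoleOn n f

/-- A graph is chordal if it has no hole. -/
def SimpleGraph.Chordal {V : Type*} (G : SimpleGraph V) : Prop := ¬ G.HasHole

/-- `G` contains an induced copy of `H`. -/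
def SimpleGraph.HasInducedCopy {V W : Type*} (G : SimpleGraph V) (H : SimpleGraph W) : Prop :=
  ∃ f : W → V, Function.Injective f ∧ ∀ a b : W, G.Adj (f a) (f b) ↔ H.Adj a b

/-- The claw `K_{1,3}`, centered at vertex `0`. -/
def clawGraph : SimpleGraph (Fin 4) := SimpleGraph.fromRel (fun a _ => a = 0)

/-- The tent `S_3`: triangle on `0,1,2`; vertex `i+3` adjacent to `{0,1,2} \ {i}`. -/
def tentGraph : SimpleGraph (Fin 6) := SimpleGraph.fromRel (fun a b =>
  (a.val < 3 ∧ b.val < 3) ∨ (a.val < 3 ∧ 3 ≤ b.val ∧ b.val ≠ a.val + 3))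

/-- The net: triangle on `0,1,2`; pendant vertex `i+3` adjacent exactly to `i`. -/
def netGraph : SimpleGraph (Fin 6) := SimpleGraph.fromRel (fun a b =>
  (a.val < 3 ∧ b.val < 3) ∨ (a.val < 3 ∧ b.val = a.val + 3))

/-- The cycle `C_n` on `ZMod n`. -/
def cycleG (n : ℕ) : SimpleGraph (ZMod n) := SimpleGraph.fromRel (fun a b => a = b + 1)

/-- The wheel `W_n`: a cycle `C_n` plus a hub (`none`) adjacent to all cycle vertices. -/
def wheelG (n : ℕ) : SimpleGraph (Option (ZMod n)) := SimpleGraph.fromRel (fun a b =>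
  a = none ∨ ∃ i j : ZMod n, a = some i ∧ b = some j ∧ i = j + 1)

/-- `C*_n`: a cycle `C_n` plus an isolated vertex (`none`). -/
def cycleStarG (n : ℕ) : SimpleGraph (Option (ZMod n)) := SimpleGraph.fromRel (fun a b =>
  ∃ i j : ZMod n, a = some i ∧ b = some j ∧ i = j + 1)

/-- Raw data of a family of closed arcs on the circle `ℝ/Lℤ`: each vertex `v` gets the
arc traversed clockwise from (the image of) `src v` to `src v + len v`. -/
structure PreArcModel (V : Type*) where
  L : ℝ
  L_pos : 0 < L
  src : V → ℝ
  len : V → ℝ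
  len_pos : ∀ v, 0 < len v
  len_lt : ∀ v, len v < L

namespace PreArcModel

variable {V : Type*}

/-- The counterclockwise endpoint of the arc of `v`. -/
noncomputable def ccp (A : PreArcModel V) (v : V) : AddCircle A.L := (A.src v : ℝ)

/-- The clockwise endpoint of the arc of `v`. -/
noncomputable def cp (A : PreArcModel V) (v : V) : AddCircle A.L :=
  ((A.src v + A.len v : ℝ) : AddCircle A.L)

/-- The closed arc assigned to `v`, as a subset of the circle. -/
noncomputable def arc (A : PreArcModel V) (v : V) : Set (AddCircle A.L) :=
  (fun x : ℝ => (x : AddCircle A.L)) '' Set.Icc (A.src v) (A.src v + A.len v)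

/-- All endpoints of all arcs are pairwise distinct. -/
def EndpointsDistinct (A : PreArcModel V) : Prop :=
  Function.Injective (fun p : V × Bool => if p.2 then A.cp p.1 else A.ccp p.1)

/-- `A` is an arc model of the graph `G`: endpoints are pairwise distinct and two
distinct vertices are adjacent iff their arcs intersect. -/
def IsModelOf (A : PreArcModel V) (G : SimpleGraph V) : Prop :=
  A.EndpointsDistinct ∧ ∀ u v : V, u ≠ v → (G.Adj u v ↔ (A.arc u ∩ A.arc v).Nonempty)

/-- No arc is properly contained in another arc. -/
def Proper (A : PreArcModel V) : Prop := ∀ u v : V, ¬ A.arc u ⊂ A.arc v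

/-- Every set of pairwise intersecting arcs has a common point. -/
def Helly (A : PreArcModel V) : Prop :=
  ∀ S : Set V, (∀ u ∈ S, ∀ v ∈ S, (A.arc u ∩ A.arc v).Nonempty) →
    (⋂ v ∈ S, A.arc v).Nonempty

/-- The set `K_A(α)` of vertices whose arc contains the point `α`. -/
noncomputable def K (A : PreArcModel V) (α : AddCircle A.L) : Set V := {v | α ∈ A.arc v}

/-- The edge set `E→_A(α)`: edges `vu` of `G` with `v ∈ K_A(α)`, `u ∉ K_A(α)`,
and `A(v)` intersecting `A(u)` from the left (`cp v ∈ A(u)`). -/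
noncomputable def Eout (A : PreArcModel V) (G : SimpleGraph V) (α : AddCircle A.L) :
    Set (Sym2 V) :=
  {e | ∃ v u : V, e = s(v, u) ∧ G.Adj v u ∧ α ∈ A.arc v ∧ α ∉ A.arc u ∧ A.cp v ∈ A.arc u}

/-- The edge set `E→_{A - Vm}(α)` of the model obtained by removing the arcs of `Vm`. -/
noncomputable def EoutAvoid (A : PreArcModel V) (G : SimpleGraph V) (Vm : Set V)
    (α : AddCircle A.L) : Set (Sym2 V) :=
  {e | ∃ v u : V, e = s(v, u) ∧ G.Adj v u ∧ v ∉ Vm ∧ u ∉ Vm ∧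
    α ∈ A.arc v ∧ α ∉ A.arc u ∧ A.cp v ∈ A.arc u}

end PreArcModel

/-- A proper Helly circular-arc graph: a graph admitting an arc model that is both
proper and Helly. -/
def SimpleGraph.IsPHCA {V : Type*} (G : SimpleGraph V) : Prop :=
  ∃ A : PreArcModel V, A.IsModelOf G ∧ A.Proper ∧ A.Helly

/-- Adjacency pattern of a fat `W_5` among the six clique-classes: classes `0..4`
form the fat hole (consecutive classes modulo 5 are completely adjacent), class `5`
is the hub (completely adjacent to everything), and each class is a clique. -/
def fatW5Rel (p q : Fin 6) : Prop :=
  p = q ∨ p = 5 ∨ q = 5 ∨ (p.val + 1) % 5 = q.val ∨ (q.val + 1) % 5 = p.val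

/-- A fat `W_5`: vertex set partitioned into six nonempty cliques with the `W_5`
adjacency pattern between the classes. -/
def SimpleGraph.IsFatW5 {V : Type*} (G : SimpleGraph V) : Prop :=
  ∃ part : V → Fin 6, Function.Surjective part ∧
    ∀ u v : V, u ≠ v → (G.Adj u v ↔ fatW5Rel (part u) (part v))

/-- `Gb` is a maximum spanning unit interval subgraph of `G`. -/
def IsMaxSpanningUIG {V : Type*} (G Gb : SimpleGraph V) : Prop :=
  Gb ≤ G ∧ Gb.IsUnitIntervalGraph ∧
    ∀ H : SimpleGraph V, H ≤ G → H.IsUnitIntervalGraph →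
      H.edgeSet.ncard ≤ Gb.edgeSet.ncard

/-- `(Vm, Em, Ep)` is an editing set of `G`: `Em` is a set of edges of `G - Vm`,
`Ep` a set of non-edges of `G - Vm`, and deleting `Em` and adding `Ep` makes
`G - Vm` a unit interval graph. -/
def IsEditingSet {V : Type*} (G : SimpleGraph V) (Vm : Set V) (Em Ep : Set (Sym2 V)) : Prop :=
  Em ⊆ G.edgeSet ∧ (∀ e ∈ Em, ∀ x ∈ e, x ∉ Vm) ∧
  (∀ e ∈ Ep, ¬ e.IsDiag ∧ e ∉ G.edgeSet ∧ ∀ x ∈ e, x ∉ Vm) ∧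
  ((SimpleGraph.fromEdgeSet ((G.edgeSet \ Em) ∪ Ep)).induce {v | v ∉ Vm}).IsUnitIntervalGraph



namespace SimpleGraph

/-- An orientation `D` of `G` without directed triangles in which every two out-neighbours, and
every two in-neighbours, of a vertex are adjacent. -/
structure IsRoundOrientation {V : Type*} (G : SimpleGraph V) (D : V → V → Prop) : Prop where
  adj_iff : ∀ u v, G.Adj u v ↔ D u v ∨ D v u
  asymm : ∀ ⦃u v⦄, D u v → ¬ D v u
  acyclic : ∀ ⦃u v w⦄, D u v → D v w → ¬ D w u
  out_adj : ∀ ⦃v a b⦄, D v a → D v b → a ≠ b → D a b ∨ D b a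
  in_adj : ∀ ⦃v a b⦄, D a v → D b v → a ≠ b → D a b ∨ D b a

namespace IsRoundOrientation

variable {V : Type*} {G : SimpleGraph V} {D : V → V → Prop}

theorem irrefl (h : G.IsRoundOrientation D) (u : V) : ¬ D u u := fun hu => h.asymm hu hu

theorem rev (h : G.IsRoundOrientation D) : G.IsRoundOrientation fun u v => D v u where
  adj_iff u v := (h.adj_iff u v).trans or_comm
  asymm _ _ h₁ h₂ := h.asymm h₁ h₂
  acyclic _ _ _ h₁ h₂ h₃ := h.acyclic h₂ h₁ h₃
  out_adj _ _ _ h₁ h₂ hne := (h.in_adj h₁ h₂ hne).symm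
  in_adj _ _ _ h₁ h₂ hne := (h.out_adj h₁ h₂ hne).symm

theorem exists_source [Finite V] (h : G.IsRoundOrientation D) {S : Set V} (hS : S.Nonempty)
    (hpair : ∀ a ∈ S, ∀ b ∈ S, a ≠ b → D a b ∨ D b a) : ∃ x ∈ S, ∀ y ∈ S, y ≠ x → D x y := by
  let r : S → S → Prop := fun a b => D a b
  have htrans : IsTrans S r := ⟨fun a b c hab hbc => by
    have hac : (a : V) ≠ c := by
      rintro hac
      exact h.asymm hab (hac ▸ hbc)
    rcases hpair a a.2 c c.2 hac with hD | hD
    · exact hD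
    · exact absurd hD (h.acyclic hab hbc)⟩
  have hirr : Std.Irrefl r := ⟨fun a => h.irrefl a⟩
  have hwf : WellFounded r := Finite.wellFounded_of_trans_of_irrefl r
  obtain ⟨x, -, hx⟩ := hwf.has_min Set.univ ⟨⟨_, hS.some_mem⟩, trivial⟩
  refine ⟨x, x.2, fun y hy hne => ?_⟩
  rcases hpair x x.2 y hy hne.symm with hD | hD
  · exact hD
  · exact absurd hD (hx ⟨y, hy⟩ trivial)

/-- The immediate successors of a round orientation extend to a permutation. -/
theorem exists_perm [Finite V] (h : G.IsRoundOrientation D) : ∃ σ : Equiv.Perm V,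
    ∀ u w, D u w → D u (σ u) ∧ (w ≠ σ u → D (σ u) w) := by
  classical
  have hs : ∀ u : {u // ∃ w, D u w}, ∃ x, D u x ∧ ∀ y, D u y → y ≠ x → D x y := fun u =>
    h.exists_source (S := {w | D u w}) u.2 fun a ha b hb hne => h.out_adj ha hb hne
  choose s hs₁ hs₂ using hs
  have hinj : Function.Injective s := by
    have key : ∀ u v, s u = s v → ¬ D u v := by
      intro u v huv hD
      have hne : (v : V) ≠ s u := fun hv => h.irrefl v (by simpa [← huv, ← hv] using hs₁ v)
      exact h.asymm (huv ▸ hs₂ u v hD hne) (hs₁ v)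
    intro u v huv
    by_contra hne
    rcases h.in_adj (hs₁ u) (huv ▸ hs₁ v) (fun hc => hne (Subtype.ext hc)) with hD | hD
    · exact key u v huv hD
    · exact key v u huv.symm hD
  obtain ⟨σ, hσ⟩ := Equiv.Perm.exists_extending_pair (fun u : {u // ∃ w, D u w} => (u : V)) s
    Subtype.val_injective hinj
  refine ⟨σ, fun u w hw => ?_⟩
  have := hσ ⟨u, w, hw⟩
  simp only at this
  rw [this]
  exact ⟨hs₁ ⟨u, w, hw⟩, hs₂ ⟨u, w, hw⟩ w hw⟩

/-- An initial segment of an out-neighbourhood is an initial segment of the forward orbit. -/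
theorem mem_initial_iff [Finite V] (h : G.IsRoundOrientation D) {σ : Equiv.Perm V}
    (hσ : ∀ u w, D u w → D u (σ u) ∧ (w ≠ σ u → D (σ u) w)) (n : ℕ) :
    ∀ (u : V) (I : Finset V), I.card = n → (∀ w ∈ I, D u w) →
      (∀ x w, D u x → D x w → w ∈ I → x ∈ I) →
      ∀ w, w ∈ I ↔ ∃ k, 1 ≤ k ∧ k ≤ n ∧ w = (σ ^ k) u := by
  classical
  induction n with
  | zero =>
    intro u I hI _ _ w
    rw [Finset.card_eq_zero] at hI
    subst hI
    simp only [Finset.notMem_empty, false_iff]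
    rintro ⟨k, h₁, h₂, -⟩
    omega
  | succ n ih =>
    intro u I hI hsub hinit w
    obtain ⟨y, hy⟩ := Finset.card_pos.1 (by omega : 0 < I.card)
    have hu : D u (σ u) := (hσ u y (hsub y hy)).1
    have hmem : σ u ∈ I := by
      by_cases hyu : y = σ u
      · exact hyu ▸ hy
      · exact hinit _ y hu ((hσ u y (hsub y hy)).2 hyu) hy
    have hrec := ih (σ u) (I.erase (σ u)) (by rw [Finset.card_erase_of_mem hmem]; omega)
      (fun w hw => (hσ u w (hsub w (Finset.mem_of_mem_erase hw))).2 (Finset.ne_of_mem_erase hw))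
      (fun x w hx hxw hw => by
        have hwI := Finset.mem_of_mem_erase hw
        have hxu : x ≠ σ u := fun hc => h.irrefl x (by simpa [hc] using hx)
        refine Finset.mem_erase.2 ⟨hxu, ?_⟩
        have hne : u ≠ x := fun hc => h.asymm hu (hc ▸ hx)
        rcases h.in_adj (hsub w hwI) hxw hne with hD | hD
        · exact hinit x w hD hxw hwI
        · exact absurd hD (h.acyclic hu hx)) w
    constructor
    · intro hw
      by_cases hwu : w = σ u
      · exact ⟨1, le_rfl, by omega, by simpa using hwu⟩
      · obtain ⟨k, h₁, h₂, rfl⟩ := hrec.1 (Finset.mem_erase.2 ⟨hwu, hw⟩)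
        exact ⟨k + 1, by omega, by omega, by rw [pow_succ]; rfl⟩
    · rintro ⟨k, h₁, h₂, rfl⟩
      obtain ⟨k, rfl⟩ := Nat.exists_eq_add_of_le' h₁
      rcases Nat.eq_zero_or_pos k with rfl | hk
      · simpa using hmem
      · exact Finset.mem_of_mem_erase (hrec.2 ⟨k, hk, by omega, by rw [pow_succ]; rfl⟩)

/-- A connected graph with a round orientation is laid out along a cyclic permutation. -/
theorem exists_cyclic_layout [Fintype V] (h : G.IsRoundOrientation D) (hconn : G.Connected) :
    ∃ (σ : Equiv.Perm V) (d : V → ℕ), σ.IsCycleOn (Finset.univ : Finset V) ∧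
      (∀ u w, D u w ↔ ∃ k, 1 ≤ k ∧ k ≤ d u ∧ w = (σ ^ k) u) ∧
      (∀ u, d u < Fintype.card V) ∧ ∀ u, d u ≤ d (σ u) + 1 := by
  classical
  obtain ⟨σ, hσ⟩ := h.exists_perm
  have hD : ∀ u w, D u w ↔
      ∃ k, 1 ≤ k ∧ k ≤ (Finset.univ.filter (D u)).card ∧ w = (σ ^ k) u := fun u w => by
    simpa using h.mem_initial_iff hσ _ u (Finset.univ.filter (D u)) rfl
      (fun w hw => by simpa using hw) (fun x w hx _ _ => by simpa using hx) w
  refine ⟨σ, fun u => (Finset.univ.filter (D u)).card, ?_, hD, fun u => ?_, fun u => ?_⟩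
  · refine ⟨by simp, fun x _ y _ => ?_⟩
    have hadj : ∀ a b, G.Adj a b → σ.SameCycle a b := by
      intro a b hab
      rcases (h.adj_iff a b).1 hab with hd | hd
      · obtain ⟨k, -, -, rfl⟩ := (hD _ _).1 hd
        exact ⟨k, by simp⟩
      · obtain ⟨k, -, -, rfl⟩ := (hD _ _).1 hd
        exact Equiv.Perm.SameCycle.symm ⟨k, by simp⟩
    obtain ⟨p⟩ := hconn.preconnected x y
    induction p with
    | nil => exact Equiv.Perm.SameCycle.refl _ _
    | cons hab _ ih => exact (hadj _ _ hab).trans (ih (by simp) (by simp))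
  · refine Finset.card_lt_univ_of_notMem (x := u) ?_
    simpa using h.irrefl u
  · have hsub : (Finset.univ.filter (D u)).erase (σ u) ⊆ Finset.univ.filter (D (σ u)) := by
      intro w hw
      simp only [Finset.mem_erase, Finset.mem_filter, Finset.mem_univ, true_and] at hw ⊢
      exact (hσ u w hw.2).2 hw.1
    have := Finset.card_le_card hsub
    have := Finset.pred_card_le_card_erase (s := Finset.univ.filter (D u)) (a := σ u)
    dsimp only
    omega

end IsRoundOrientation

end SimpleGraph

theorem AddCircle.coe_eq_coe_iff_exists_int {L x y : ℝ} :
    (x : AddCircle L) = y ↔ ∃ m : ℤ, x + m * L = y := by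
  rw [eq_comm, ← sub_eq_zero, ← AddCircle.coe_sub, AddCircle.coe_eq_zero_iff]
  refine exists_congr fun m => ?_
  rw [zsmul_eq_mul]
  constructor <;> intro h <;> linarith

namespace PreArcModel

variable {V : Type*} (A : PreArcModel V)

theorem coe_mem_arc_iff {v : V} {x : ℝ} : (x : AddCircle A.L) ∈ A.arc v ↔
    ∃ m : ℤ, A.src v ≤ x + m * A.L ∧ x + m * A.L ≤ A.src v + A.len v := by
  constructor
  · rintro ⟨y, ⟨h₁, h₂⟩, hy⟩
    obtain ⟨m, rfl⟩ := AddCircle.coe_eq_coe_iff_exists_int.1 hy.symm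
    exact ⟨m, h₁, h₂⟩
  · rintro ⟨m, h₁, h₂⟩
    exact ⟨_, ⟨h₁, h₂⟩, (AddCircle.coe_eq_coe_iff_exists_int.2 ⟨m, rfl⟩).symm⟩

theorem ccp_mem_arc_self (v : V) : A.ccp v ∈ A.arc v :=
  ⟨A.src v, ⟨le_rfl, by linarith [A.len_pos v]⟩, rfl⟩

theorem inter_nonempty_iff (u v : V) :
    (A.arc u ∩ A.arc v).Nonempty ↔ A.ccp v ∈ A.arc u ∨ A.ccp u ∈ A.arc v := by
  constructor
  · rintro ⟨_, ⟨x, ⟨h₁, h₂⟩, rfl⟩, hx⟩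
    obtain ⟨m, h₃, h₄⟩ := A.coe_mem_arc_iff.1 hx
    rcases le_total (A.src u + m * A.L) (A.src v) with h | h
    · refine Or.inl (A.coe_mem_arc_iff.2 ⟨-m, ?_, ?_⟩) <;> push_cast <;> linarith
    · exact Or.inr (A.coe_mem_arc_iff.2 ⟨m, by linarith, by linarith⟩)
  · rintro (h | h)
    · exact ⟨_, h, A.ccp_mem_arc_self v⟩
    · exact ⟨_, A.ccp_mem_arc_self u, h⟩

end PreArcModel

namespace SimpleGraph.IsRoundOrientation

variable {V : Type*} {G : SimpleGraph V} {D : V → V → Prop}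

theorem isPHCA [Fintype V] (h : G.IsRoundOrientation D) (hconn : G.Connected) : G.IsPHCA := by
  classical
  obtain ⟨σ, d, hσ, hD, hdlt, hdsucc⟩ := h.exists_cyclic_layout hconn
  obtain ⟨r⟩ := hconn.nonempty
  set n := Fintype.card V with hn
  have hpos : ∀ v, ∃ k < n, (σ ^ k) r = v := fun v =>
    hσ.exists_pow_eq (Finset.mem_univ r) (Finset.mem_univ v)
  choose pos hposlt hpos using hpos
  have hn0 : 0 < n := Fintype.card_pos_iff.2 ⟨r⟩
  have hshift : ∀ u w (k : ℕ), w = (σ ^ k) u ↔ ∃ m : ℤ, (pos w : ℤ) + m * n = pos u + k := by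
    intro u w k
    have hiff := hσ.pow_apply_eq_pow_apply (Finset.mem_univ r) (m := pos w) (n := k + pos u)
    rw [pow_add, Equiv.Perm.mul_apply, hpos, hpos, ← Int.natCast_modEq_iff,
      Int.modEq_iff_dvd] at hiff
    rw [hiff]
    simp only [Finset.card_univ, ← hn]
    constructor
    · rintro ⟨m, hm⟩
      refine ⟨m, ?_⟩
      push_cast at hm
      linarith
    · rintro ⟨m, hm⟩
      refine ⟨m, ?_⟩
      push_cast
      linarith
  have hditer : ∀ j u, d u ≤ d ((σ ^ j) u) + j := by
    intro j
    induction j with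
    | zero => simp
    | succ j ih =>
      intro u
      have h₁ := ih u
      have h₂ := hdsucc ((σ ^ j) u)
      rw [← Equiv.Perm.mul_apply, ← pow_succ'] at h₂
      omega
  have hn' : (0 : ℝ) < n := by exact_mod_cast hn0
  have hdR : ∀ v, (d v : ℝ) + 1 ≤ n := fun v => by exact_mod_cast hdlt v
  have hd0 : ∀ v, (0 : ℝ) ≤ d v := fun v => Nat.cast_nonneg _
  -- the fractional part of an arc length
  set φ : V → ℝ := fun v => 1 / 2 - d v / (2 * n + 2) with hφ
  have hφeq : ∀ v, d v = (1 / 2 - φ v) * (2 * n + 2) := fun v => by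
    simp only [hφ]; field_simp; ring
  have hφpos : ∀ v, 0 < φ v := fun v => by
    by_contra hc
    nlinarith [hφeq v, hdR v]
  have hφle : ∀ v, φ v ≤ 1 / 2 := fun v => by
    by_contra hc
    nlinarith [hφeq v, hd0 v]
  let A : PreArcModel V :=
    { L := n
      L_pos := hn'
      src := fun v => pos v
      len := fun v => d v + φ v
      len_pos := fun v => by linarith [hd0 v, hφpos v]
      len_lt := fun v => by linarith [hdR v, hφle v] }
  have hccp : ∀ v w, A.ccp w ∈ A.arc v ↔ w = v ∨ D v w := by
    intro v w
    refine (A.coe_mem_arc_iff (x := (pos w : ℝ))).trans ?_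
    change (∃ m : ℤ, (pos v : ℝ) ≤ pos w + m * n ∧ pos w + m * n ≤ pos v + (d v + φ v)) ↔ _
    constructor
    · rintro ⟨m, h₁, h₂⟩
      have h₁' : (pos v : ℤ) ≤ pos w + m * n := by exact_mod_cast h₁
      obtain ⟨k, hk⟩ := Int.le.dest h₁'
      have hkR : (pos v : ℝ) + k = pos w + m * n := by exact_mod_cast hk
      have hw := (hshift v w k).2 ⟨m, hk.symm⟩
      rcases Nat.eq_zero_or_pos k with rfl | hk0
      · exact Or.inl (by simpa using hw)
      · refine Or.inr ((hD v w).2 ⟨k, hk0, ?_, hw⟩)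
        have : (k : ℝ) < d v + 1 := by linarith [hφle v]
        exact Nat.lt_succ_iff.1 (by exact_mod_cast this)
    · rintro (rfl | hvw)
      · exact ⟨0, by simp, by have := hd0 w; have := hφpos w; push_cast; linarith⟩
      · obtain ⟨k, hk₁, hk₂, hw⟩ := (hD v w).1 hvw
        obtain ⟨m, hm⟩ := (hshift v w k).1 hw
        have hmR : (pos w : ℝ) + m * n = pos v + k := by exact_mod_cast hm
        have hkR : (k : ℝ) ≤ d v := by exact_mod_cast hk₂
        exact ⟨m, by rw [hmR]; linarith [(Nat.cast_nonneg k : (0 : ℝ) ≤ k)],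
          by rw [hmR]; linarith [hφpos v]⟩
  have hpos_inj : ∀ u v, (∃ m : ℤ, (pos u : ℤ) + m * n = pos v) → u = v := by
    rintro u v ⟨m, hm⟩
    simpa using (hshift v u 0).2 ⟨m, by simpa using hm⟩
  have hccp_ne_cp : ∀ u v, A.ccp u ≠ A.cp v := by
    intro u v huv
    obtain ⟨m, hm⟩ := AddCircle.coe_eq_coe_iff_exists_int.1 huv
    change (pos u : ℝ) + m * n = pos v + (d v + φ v) at hm
    have h₁ : ((pos v + d v : ℤ) : ℝ) < (pos u + m * n : ℤ) := by
      push_cast; linarith [hφpos v]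
    have h₂ : ((pos u + m * n : ℤ) : ℝ) < (pos v + d v + 1 : ℤ) := by
      push_cast; linarith [hφle v]
    have h₁' := Int.cast_lt.1 h₁
    have h₂' := Int.cast_lt.1 h₂
    omega
  refine ⟨A, ⟨?_, ?_⟩, ?_, ?_⟩
  · rintro ⟨u, b⟩ ⟨v, c⟩ huv
    cases b <;> cases c <;> simp only [Bool.false_eq_true, if_true, if_false] at huv
    · obtain ⟨m, hm⟩ := AddCircle.coe_eq_coe_iff_exists_int.1 huv
      change (pos u : ℝ) + m * n = pos v at hm
      rw [hpos_inj u v ⟨m, by exact_mod_cast hm⟩]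
    · exact absurd huv (hccp_ne_cp _ _)
    · exact absurd huv.symm (hccp_ne_cp _ _)
    · obtain ⟨m, hm⟩ := AddCircle.coe_eq_coe_iff_exists_int.1 huv
      change (pos u : ℝ) + (d u + φ u) + m * n = pos v + (d v + φ v) at hm
      have h₁ : ((pos u + d u + m * n : ℤ) : ℝ) < (pos v + d v + 1 : ℤ) := by
        push_cast; linarith [hφpos u, hφle v]
      have h₂ : ((pos v + d v : ℤ) : ℝ) < (pos u + d u + m * n + 1 : ℤ) := by
        push_cast; linarith [hφpos v, hφle u]
      have h₁' := Int.cast_lt.1 h₁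
      have h₂' := Int.cast_lt.1 h₂
      have heq : (pos u + d u + m * n : ℤ) = pos v + d v := by omega
      have heqR : (pos u + d u + m * n : ℝ) = pos v + d v := by exact_mod_cast heq
      have hφuv : φ u = φ v := by linarith
      have hduv : (d u : ℝ) = d v := by rw [hφeq, hφeq, hφuv]
      rw [hpos_inj u v ⟨m, by
        have : (d u : ℤ) = d v := by exact_mod_cast hduv
        linarith⟩]
  · intro u v huv
    rw [A.inter_nonempty_iff, hccp, hccp, h.adj_iff]
    simp [huv, huv.symm]
  · rintro u v ⟨hsub, hnsub⟩
    rcases (hccp v u).1 (hsub (A.ccp_mem_arc_self u)) with rfl | hvu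
    · exact hnsub subset_rfl
    obtain ⟨j, hj₁, hj₂, hu⟩ := (hD v u).1 hvu
    obtain ⟨m, hm⟩ := (hshift v u j).1 hu
    have hmR : (pos u : ℝ) + m * n = pos v + j := by exact_mod_cast hm
    have hdj : (d v : ℝ) ≤ d u + j := by
      have := hditer j v
      rw [← hu] at this
      exact_mod_cast this
    have hj₁R : (1 : ℝ) ≤ j := by exact_mod_cast hj₁
    have hj₂R : (j : ℝ) ≤ d v := by exact_mod_cast hj₂
    -- the arc of `u` ends strictly after the arc of `v`
    have hend : d v + φ v < d u + j + φ u := by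
      by_contra hc
      nlinarith [hφeq u, hφeq v, hn']
    set ε := min (d u + j + φ u - (d v + φ v)) (1 / 4) with hε
    have hε0 : 0 < ε := lt_min (by linarith) (by norm_num)
    have hε1 : ε ≤ d u + j + φ u - (d v + φ v) := min_le_left _ _
    have hε2 : ε ≤ 1 / 4 := min_le_right _ _
    have hy : ((pos v + (d v + φ v) + ε : ℝ) : AddCircle A.L) ∈ A.arc u := by
      refine A.coe_mem_arc_iff.2 ⟨-m, ?_, ?_⟩
      · change (pos u : ℝ) ≤ pos v + (d v + φ v) + ε + (-m : ℤ) * n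
        push_cast
        linarith [hφpos v]
      · change pos v + (d v + φ v) + ε + (-m : ℤ) * n ≤ (pos u : ℝ) + (d u + φ u)
        push_cast
        linarith
    obtain ⟨l, hl₁, hl₂⟩ := A.coe_mem_arc_iff.1 (hsub hy)
    change (pos v : ℝ) ≤ pos v + (d v + φ v) + ε + l * n at hl₁
    change pos v + (d v + φ v) + ε + l * n ≤ (pos v : ℝ) + (d v + φ v) at hl₂
    have hl0 : (l : ℝ) < 0 := by
      by_contra hc
      nlinarith
    have hl1 : l ≤ -1 := by
      have : l < 0 := by exact_mod_cast hl0
      omega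
    have hl1R : (l : ℝ) ≤ -1 := by exact_mod_cast hl1
    nlinarith [hdR v, hφle v]
  · intro S hS
    rcases S.eq_empty_or_nonempty with rfl | hne
    · exact ⟨0, by simp⟩
    · have hpair : ∀ a ∈ S, ∀ b ∈ S, a ≠ b → D b a ∨ D a b := by
        intro a ha b hb hab
        have := (A.inter_nonempty_iff a b).1 (hS a ha b hb)
        rw [hccp, hccp] at this
        simp only [hab, hab.symm, false_or] at this
        exact this.symm
      obtain ⟨x, hx, hmax⟩ := h.rev.exists_source hne hpair
      refine ⟨A.ccp x, Set.mem_iInter₂.2 fun y hy => (hccp y x).2 ?_⟩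
      by_cases hxy : x = y
      · exact Or.inl hxy
      · exact Or.inr (hmax y hy (Ne.symm hxy))

end SimpleGraph.IsRoundOrientation

namespace SimpleGraph

variable {V : Type*} {G : SimpleGraph V}

/-- Claw-freeness, stated on vertices. -/
def ClawFree (G : SimpleGraph V) : Prop := ∀ ⦃c x y z : V⦄, G.Adj c x → G.Adj c y → G.Adj c z →
  x ≠ y → x ≠ z → y ≠ z → ¬ G.Adj x y → ¬ G.Adj x z → ¬ G.Adj y z → False

/-- `C₄`-freeness, stated on vertices. -/
def SquareFree (G : SimpleGraph V) : Prop := ∀ ⦃a b c d : V⦄, G.Adj a b → G.Adj b c → G.Adj c d →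
  G.Adj a d → a ≠ c → b ≠ d → ¬ G.Adj a c → ¬ G.Adj b d → False

/-- Net-freeness, stated on vertices: `x y z` is the triangle and `x' y' z'` are the pendants. -/
def NetFree (G : SimpleGraph V) : Prop := ∀ ⦃x y z x' y' z' : V⦄,
  G.Adj x y → G.Adj x z → G.Adj y z → G.Adj x x' → G.Adj y y' → G.Adj z z' →
  ¬ G.Adj x y' → ¬ G.Adj x z' → ¬ G.Adj y x' → ¬ G.Adj y z' → ¬ G.Adj z x' → ¬ G.Adj z y' →
  ¬ G.Adj x' y' → ¬ G.Adj x' z' → ¬ G.Adj y' z' → False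

/-- Tent-freeness, stated on vertices: `x y z` is the triangle and `x' y' z'` are opposite to
`x`, `y`, `z`. -/
def TentFree (G : SimpleGraph V) : Prop := ∀ ⦃x y z x' y' z' : V⦄,
  G.Adj x y → G.Adj x z → G.Adj y z → G.Adj x y' → G.Adj x z' → G.Adj y x' → G.Adj y z' →
  G.Adj z x' → G.Adj z y' → ¬ G.Adj x x' → ¬ G.Adj y y' → ¬ G.Adj z z' →
  ¬ G.Adj x' y' → ¬ G.Adj x' z' → ¬ G.Adj y' z' → False

theorem clawFree_of_not_hasInducedCopy (h : ¬ G.HasInducedCopy clawGraph) : G.ClawFree := by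
  intro c x y z hcx hcy hcz hxy hxz hyz nxy nxz nyz
  refine h ⟨![c, x, y, z], ?_, ?_⟩
  · have := hcx.ne
    have := hcy.ne
    have := hcz.ne
    intro i j hij
    fin_cases i <;> fin_cases j <;> simp_all
  · intro i j
    fin_cases i <;> fin_cases j <;> simp_all [clawGraph, G.adj_comm]

theorem squareFree_of_not_hasInducedCopy (h : ¬ G.HasInducedCopy (cycleG 4)) : G.SquareFree := by
  intro a b c d hab hbc hcd had hac hbd nac nbd
  refine h ⟨(![a, b, c, d] : Fin 4 → V), ?_, ?_⟩
  · have := hab.ne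
    have := hbc.ne
    have := hcd.ne
    have := had.ne
    have hinj : Function.Injective ![a, b, c, d] := by
      intro i j hij
      fin_cases i <;> fin_cases j <;> simp_all
    exact hinj
  · have key : ∀ i j : Fin 4, (cycleG 4).Adj i j ↔ i ≠ j ∧ (i = j + 1 ∨ j = i + 1) := fun _ _ =>
      Iff.rfl
    intro (i : Fin 4) (j : Fin 4)
    rw [key]
    fin_cases i <;> fin_cases j <;> simp_all [G.adj_comm]

theorem netFree_of_not_hasInducedCopy (h : ¬ G.HasInducedCopy netGraph) : G.NetFree := by
  intro x y z x' y' z' h₁ h₂ h₃ h₄ h₅ h₆ n₁ n₂ n₃ n₄ n₅ n₆ n₇ n₈ n₉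
  refine h ⟨![x, y, z, x', y', z'], ?_, ?_⟩
  · have e₁ : x' ≠ y' := fun e => n₁ (e ▸ h₄)
    have e₂ : x' ≠ z' := fun e => n₂ (e ▸ h₄)
    have e₃ : y' ≠ z' := fun e => n₄ (e ▸ h₅)
    have e₄ : x ≠ y' := fun e => n₇ (e ▸ h₄.symm)
    have e₅ : x ≠ z' := fun e => n₈ (e ▸ h₄.symm)
    have e₆ : y ≠ x' := fun e => n₇ (e ▸ h₅)
    have e₇ : y ≠ z' := fun e => n₉ (e ▸ h₅.symm)
    have e₈ : z ≠ x' := fun e => n₈ (e ▸ h₆)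
    have e₉ : z ≠ y' := fun e => n₉ (e ▸ h₆)
    have := h₁.ne
    have := h₂.ne
    have := h₃.ne
    have := h₄.ne
    have := h₅.ne
    have := h₆.ne
    clear h₁ h₂ h₃ h₄ h₅ h₆ n₁ n₂ n₃ n₄ n₅ n₆ n₇ n₈ n₉
    intro i j hij
    fin_cases i <;> fin_cases j <;> simp_all
  · intro i j
    fin_cases i <;> fin_cases j <;> simp_all [netGraph, G.adj_comm]

theorem tentFree_of_not_hasInducedCopy (h : ¬ G.HasInducedCopy tentGraph) : G.TentFree := by
  intro x y z x' y' z' h₁ h₂ h₃ h₄ h₅ h₆ h₇ h₈ h₉ n₁ n₂ n₃ n₄ n₅ n₆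
  refine h ⟨![x, y, z, x', y', z'], ?_, ?_⟩
  · have e₁ : x' ≠ y' := fun e => n₂ (e ▸ h₆)
    have e₂ : x' ≠ z' := fun e => n₃ (e ▸ h₈)
    have e₃ : y' ≠ z' := fun e => n₃ (e ▸ h₉)
    have e₄ : x ≠ x' := fun e => n₄ (e ▸ h₄)
    have e₅ : y ≠ y' := fun e => n₄ (e ▸ h₆.symm)
    have e₆ : z ≠ z' := fun e => n₅ (e ▸ h₈.symm)
    have := h₁.ne
    have := h₂.ne
    have := h₃.ne
    have := h₄.ne
    have := h₅.ne
    have := h₆.ne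
    have := h₇.ne
    have := h₈.ne
    have := h₉.ne
    clear h₁ h₂ h₃ h₄ h₅ h₆ h₇ h₈ h₉ n₁ n₂ n₃ n₄ n₅ n₆
    intro i j hij
    fin_cases i <;> fin_cases j <;> simp_all
  · intro i j
    fin_cases i <;> fin_cases j <;> simp_all [tentGraph, G.adj_comm]

/-- `Q u v d` says that `v` lies `d` steps after `u`, in a linear or cyclic arrangement of the
vertices whose period, if any, is at least ten. -/
structure IsOffset (Q : V → V → ℕ → Prop) : Prop where
  refl : ∀ u, Q u u 0
  eq_zero : ∀ ⦃u m⦄, Q u u m → m < 10 → m = 0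
  trans : ∀ ⦃u v w i j⦄, Q u v i → Q v w j → Q u w (i + j)
  left : ∀ ⦃v a b i j⦄, Q v a i → Q v b j → i ≤ j → Q a b (j - i)
  right : ∀ ⦃v a b i j⦄, Q a v i → Q b v j → i ≤ j → Q b a (j - i)

theorem IsOffset.rev {Q : V → V → ℕ → Prop} (hQ : IsOffset Q) :
    IsOffset fun u v d => Q v u d where
  refl := hQ.refl
  eq_zero _ _ h₁ h₂ := hQ.eq_zero h₁ h₂
  trans _ _ _ i j h₁ h₂ := by rw [add_comm]; exact hQ.trans h₂ h₁
  left _ _ _ _ _ h₁ h₂ h := hQ.right h₁ h₂ h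
  right _ _ _ _ _ h₁ h₂ h := hQ.left h₁ h₂ h

/-- Two vertices at offset at most one are adjacent, adjacent vertices have offset at most three,
and adjacency at offset three is inherited by the vertices in between. -/
structure IsCoarseLayout (G : SimpleGraph V) (Q : V → V → ℕ → Prop) : Prop extends IsOffset Q where
  adj_of_le_one : ∀ ⦃u v d⦄, Q u v d → d ≤ 1 → u ≠ v → G.Adj u v
  offset_of_adj : ∀ ⦃u v⦄, G.Adj u v → ∃ d, d ≤ 3 ∧ (Q u v d ∨ Q v u d)
  adj_one_three : ∀ ⦃v a b⦄, Q v a 1 → Q v b 3 → G.Adj v b → G.Adj a b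
  adj_one_three' : ∀ ⦃v a b⦄, Q a v 1 → Q b v 3 → G.Adj v b → G.Adj a b

namespace IsCoarseLayout

variable {Q : V → V → ℕ → Prop}

theorem rev (h : G.IsCoarseLayout Q) : G.IsCoarseLayout fun u v d => Q v u d where
  toIsOffset := h.toIsOffset.rev
  adj_of_le_one _ _ _ h₁ h₂ h₃ := (h.adj_of_le_one h₁ h₂ h₃.symm).symm
  offset_of_adj _ _ h₁ := (h.offset_of_adj h₁).imp fun _ h₂ => ⟨h₂.1, h₂.2.symm⟩
  adj_one_three _ _ _ h₁ h₂ h₃ := h.adj_one_three' h₁ h₂ h₃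
  adj_one_three' _ _ _ h₁ h₂ h₃ := h.adj_one_three h₁ h₂ h₃

theorem not_adj (h : G.IsCoarseLayout Q) {u v : V} {d : ℕ} (huv : Q u v d) (h4 : 4 ≤ d)
    (h6 : d ≤ 6) : ¬ G.Adj u v := by
  intro hadj
  obtain ⟨e, he, h₁ | h₁⟩ := h.offset_of_adj hadj
  · have := h.eq_zero (h.left h₁ huv (by omega)) (by omega)
    omega
  · have := h.eq_zero (h.trans huv h₁) (by omega)
    omega

/-- If `u` and `v` share a position and `u` has a later neighbour that `v` misses, then the
later neighbours of `v` are neighbours of `u`. -/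
theorem adj_of_later (h : G.IsCoarseLayout Q) (hsq : G.SquareFree) {u v x y : V}
    (huv : Q u v 0) (hne : u ≠ v) (hx : Q u x 2 ∨ Q u x 3) (hux : G.Adj u x) (hvx : ¬ G.Adj v x)
    (hy : Q v y 2 ∨ Q v y 3) (hvy : G.Adj v y) : G.Adj u y := by
  by_contra huy
  have hxy : x ≠ y := fun e => hvx (e ▸ hvy)
  have hadj : G.Adj x y := by
    have hy' : Q u y 2 ∨ Q u y 3 := hy.imp (fun hq => by simpa using h.trans huv hq)
      fun hq => by simpa using h.trans huv hq
    rcases hx with hx | hx <;> rcases hy' with hy' | hy'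
    · exact h.adj_of_le_one (h.left hx hy' le_rfl) (by omega) hxy
    · exact h.adj_of_le_one (h.left hx hy' (by omega)) (by omega) hxy
    · exact (h.adj_of_le_one (h.left hy' hx (by omega)) (by omega) hxy.symm).symm
    · exact h.adj_of_le_one (h.left hx hy' le_rfl) (by omega) hxy
  have h₀ : G.Adj u v := h.adj_of_le_one huv (by omega) hne
  refine hsq h₀ hvy hadj.symm hux ?_ (fun e => ?_) huy hvx
  · rintro rfl
    rcases hy with hy | hy <;> simpa using h.eq_zero (h.trans huv hy) (by omega)
  · subst e
    rcases hx with hx | hx <;> simpa using h.eq_zero (h.left huv hx (by omega)) (by omega)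

/-- If `u` and `v` share a position, `u` does not have both a later and an earlier neighbour
that `v` misses. -/
theorem adj_earlier (h : G.IsCoarseLayout Q) (hclaw : G.ClawFree) {u v x y : V}
    (huv : Q u v 0) (hne : u ≠ v) (hx : Q u x 2 ∨ Q u x 3) (hux : G.Adj u x) (hvx : ¬ G.Adj v x)
    (hy : Q y u 2 ∨ Q y u 3) (huy : G.Adj u y) : G.Adj v y := by
  by_contra hvy
  have h₀ : G.Adj u v := h.adj_of_le_one huv (by omega) hne
  have hyx : ∃ d, 4 ≤ d ∧ d ≤ 6 ∧ Q y x d := by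
    rcases hx with hx | hx <;> rcases hy with hy | hy <;>
      exact ⟨_, by omega, by omega, h.trans hy hx⟩
  obtain ⟨d, hd₁, hd₂, hq⟩ := hyx
  refine hclaw h₀ hux huy (fun e => ?_) (fun e => ?_) (fun e => ?_) hvx hvy
    fun hc => h.not_adj hq hd₁ hd₂ hc.symm
  · subst e
    rcases hx with hx | hx <;> simpa using h.eq_zero (h.left huv hx (by omega)) (by omega)
  · subst e
    rcases hy with hy | hy <;> simpa using h.eq_zero (h.trans huv hy) (by omega)
  · subst e
    have := h.eq_zero hq (by omega)
    omega

/-- The orientation obtained from a coarse layout by breaking ties with a key. -/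
def orient (G : SimpleGraph V) (Q : V → V → ℕ → Prop) (key : V → ℤ) (u v : V) : Prop :=
  G.Adj u v ∧ ∃ d, d ≤ 3 ∧ Q u v d ∧ (d = 0 → key u < key v)

theorem orient_out_adj (h : G.IsCoarseLayout Q) {key : V → ℤ}
    (hkey : ∀ u v x, Q u v 0 → key u < key v → G.Adj u x → (Q u x 2 ∨ Q u x 3) → G.Adj v x)
    {v a b : V} (ha : orient G Q key v a) (hb : orient G Q key v b) (hne : a ≠ b) :
    G.Adj a b := by
  obtain ⟨hva, i, hi, hqa, hia⟩ := ha
  obtain ⟨hvb, j, hj, hqb, hjb⟩ := hb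
  wlog hij : i ≤ j generalizing a b i j
  · exact (this hne.symm hvb j hj hqb hjb hva i hi hqa hia (by omega)).symm
  by_cases hclose : j ≤ i + 1
  · exact h.adj_of_le_one (h.left hqa hqb hij) (by omega) hne
  have hcases : i = 0 ∧ (j = 2 ∨ j = 3) ∨ i = 1 ∧ j = 3 := by omega
  rcases hcases with ⟨rfl, hj⟩ | ⟨rfl, rfl⟩
  · refine hkey v a b hqa (hia rfl) hvb ?_
    rcases hj with rfl | rfl
    · exact Or.inl hqb
    · exact Or.inr hqb
  · exact h.adj_one_three hqa hqb hvb

theorem orient_rev {key : V → ℤ} (u v : V) :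
    orient G (fun u v d => Q v u d) (fun v => - key v) u v ↔ orient G Q key v u := by
  simp [orient, G.adj_comm]

theorem isRoundOrientation_orient (h : G.IsCoarseLayout Q) {key : V → ℤ}
    (hinj : Function.Injective key)
    (hlater : ∀ u v x, Q u v 0 → key u < key v → G.Adj u x → (Q u x 2 ∨ Q u x 3) → G.Adj v x)
    (hearlier : ∀ u v x, Q u v 0 → key u < key v → G.Adj v x → (Q x v 2 ∨ Q x v 3) →
      G.Adj u x) :
    G.IsRoundOrientation (orient G Q key) := by
  have hadj : ∀ u v, G.Adj u v ↔ orient G Q key u v ∨ orient G Q key v u := by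
    refine fun u v => ⟨fun huv => ?_, fun huv => huv.elim (fun h₁ => h₁.1) fun h₁ => h₁.1.symm⟩
    obtain ⟨d, hd, hq⟩ := h.offset_of_adj huv
    rcases Nat.eq_zero_or_pos d with rfl | hd0
    · have hq₁ : Q u v 0 := hq.elim id fun hq => h.left hq (h.refl v) le_rfl
      have hq₂ : Q v u 0 := h.left hq₁ (h.refl u) le_rfl
      rcases lt_or_gt_of_ne (fun e => huv.ne (hinj e) : key u ≠ key v) with hk | hk
      · exact Or.inl ⟨huv, 0, by omega, hq₁, fun _ => hk⟩
      · exact Or.inr ⟨huv.symm, 0, by omega, hq₂, fun _ => hk⟩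
    · rcases hq with hq | hq
      · exact Or.inl ⟨huv, d, hd, hq, by omega⟩
      · exact Or.inr ⟨huv.symm, d, hd, hq, by omega⟩
  refine ⟨hadj, ?_, ?_, ?_, ?_⟩
  · rintro u v ⟨-, i, hi, hqi, hki⟩ ⟨-, j, hj, hqj, hkj⟩
    have := h.eq_zero (h.trans hqi hqj) (by omega)
    have h₁ := hki (by omega)
    have h₂ := hkj (by omega)
    omega
  · rintro u v w ⟨-, i, hi, hqi, hki⟩ ⟨-, j, hj, hqj, hkj⟩ ⟨-, l, hl, hql, hkl⟩
    have := h.eq_zero (h.trans (h.trans hqi hqj) hql) (by omega)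
    have h₁ := hki (by omega)
    have h₂ := hkj (by omega)
    have h₃ := hkl (by omega)
    omega
  · exact fun v a b ha hb hne => (hadj a b).1 (h.orient_out_adj hlater ha hb hne)
  · refine fun v a b ha hb hne => (hadj a b).1 (h.rev.orient_out_adj (v := v)
      (key := fun v => - key v) (fun u w x hq hk hux hx => ?_) ((orient_rev _ _).2 ha)
      ((orient_rev _ _).2 hb) hne)
    exact hearlier w u x hq (by omega) hux hx

theorem exists_isRoundOrientation [Fintype V] (h : G.IsCoarseLayout Q) (hclaw : G.ClawFree)
    (hsq : G.SquareFree) : ∃ D, G.IsRoundOrientation D := by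
  classical
  let F : V → Finset V := fun u => Finset.univ.filter fun x => G.Adj u x ∧ (Q u x 2 ∨ Q u x 3)
  let B : V → Finset V := fun u => Finset.univ.filter fun x => G.Adj u x ∧ (Q x u 2 ∨ Q x u 3)
  let score : V → ℤ := fun u => (F u).card - (B u).card
  let e := Fintype.equivFin V
  let key : V → ℤ := fun u => score u * Fintype.card V + (e u : ℕ)
  have hkey : ∀ u v, score u < score v → key u < key v := by
    intro u v huv
    have := (e u).isLt
    simp only [key]
    nlinarith
  have hinj : Function.Injective key := by
    intro u v huv
    rcases lt_trichotomy (score u) (score v) with hs | hs | hs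
    · exact absurd huv (hkey u v hs).ne
    · simp only [key, hs] at huv
      exact e.injective (Fin.ext (by omega))
    · exact absurd huv (hkey v u hs).ne'
  have hF : ∀ u v, Q u v 0 → ∀ x, (Q v x 2 ∨ Q v x 3 → Q u x 2 ∨ Q u x 3) := by
    intro u v huv x hx
    exact hx.imp (fun hq => by simpa using h.trans huv hq) fun hq => by simpa using h.trans huv hq
  have hB : ∀ u v, Q u v 0 → ∀ x, (Q x u 2 ∨ Q x u 3 → Q x v 2 ∨ Q x v 3) := by
    intro u v huv x hx
    exact hx.imp (fun hq => h.trans hq huv) fun hq => h.trans hq huv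
  refine ⟨_, h.isRoundOrientation_orient hinj (fun u v x huv hlt hux hx => ?_)
    (fun u v x huv hlt hvx hx => ?_)⟩
  · by_contra hvx
    have hne : u ≠ v := fun hc => hvx (hc ▸ hux)
    have hvu : Q v u 0 := h.left huv (h.refl u) le_rfl
    have hFlt : (F v).card < (F u).card := by
      refine Finset.card_lt_card ⟨fun y hy => ?_, fun hc => ?_⟩
      · simp only [F, Finset.mem_filter, Finset.mem_univ, true_and] at hy ⊢
        exact ⟨h.adj_of_later hsq huv hne hx hux hvx hy.2 hy.1, hF u v huv y hy.2⟩
      · have : x ∈ F u := by simp [F, hux, hx]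
        exact hvx (Finset.mem_filter.1 (hc this)).2.1
    have hBle : (B u).card ≤ (B v).card := by
      refine Finset.card_le_card fun y hy => ?_
      simp only [B, Finset.mem_filter, Finset.mem_univ, true_and] at hy ⊢
      exact ⟨h.adj_earlier hclaw huv hne hx hux hvx hy.2 hy.1, hB u v huv y hy.2⟩
    have := hkey v u (by simp only [score]; omega)
    omega
  · by_contra hux
    have hne : v ≠ u := fun hc => hux (hc ▸ hvx)
    have hvu : Q v u 0 := h.left huv (h.refl u) le_rfl
    have hBlt : (B u).card < (B v).card := by
      refine Finset.card_lt_card ⟨fun y hy => ?_, fun hc => ?_⟩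
      · simp only [B, Finset.mem_filter, Finset.mem_univ, true_and] at hy ⊢
        exact ⟨h.rev.adj_of_later hsq huv hne hx hvx hux hy.2 hy.1, hB u v huv y hy.2⟩
      · have : x ∈ B v := by simp [B, hvx, hx]
        exact hux (Finset.mem_filter.1 (hc this)).2.1
    have hFle : (F v).card ≤ (F u).card := by
      refine Finset.card_le_card fun y hy => ?_
      simp only [F, Finset.mem_filter, Finset.mem_univ, true_and] at hy ⊢
      exact ⟨h.rev.adj_earlier hclaw huv hne hx hvx hux hy.2 hy.1, hF u v huv y hy.2⟩
    have := hkey v u (by simp only [score]; omega)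
    omega

end IsCoarseLayout

end SimpleGraph

namespace SimpleGraph

variable {V : Type*} {G : SimpleGraph V}

theorem exists_adj_dist_eq {H : SimpleGraph V} {x y : V} {n : ℕ} (hr : H.Reachable x y)
    (hn : H.dist x y = n + 1) : ∃ z, H.Adj z y ∧ H.Reachable x z ∧ H.dist x z = n := by
  obtain ⟨p, hp⟩ := hr.symm.exists_walk_length_eq_dist
  rw [dist_comm, hn] at hp
  cases p with
  | nil => simp at hp
  | cons hadj q =>
    rename_i z
    have hzr : H.Reachable x z := ⟨q.reverse⟩
    refine ⟨z, hadj.symm, hzr, ?_⟩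
    have h₁ : H.dist x z ≤ n := by
      rw [dist_comm]
      exact (dist_le q).trans (by simpa using hp.le)
    have h₂ := hadj.symm.diff_dist_adj (u := x)
    omega

/-- A shortest path, indexed by the distance to its origin. -/
theorem exists_geodesic {H : SimpleGraph V} {x : V} (n : ℕ) : ∀ y, H.Reachable x y →
    H.dist x y = n → ∃ p : ℕ → V, p n = y ∧ (∀ i ≤ n, H.Reachable x (p i) ∧ H.dist x (p i) = i) ∧
      ∀ i < n, H.Adj (p i) (p (i + 1)) := by
  induction n with
  | zero =>
    intro y hr hy
    exact ⟨fun _ => y, rfl, fun i hi => ⟨hr, hy.trans (by omega)⟩, by simp⟩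
  | succ n ih =>
    intro y hr hy
    obtain ⟨z, hzy, hzr, hz⟩ := exists_adj_dist_eq hr hy
    obtain ⟨p, hpn, hp, hadj⟩ := ih z hzr hz
    refine ⟨fun i => if i ≤ n then p i else y, by simp, fun i hi => ?_, fun i hi => ?_⟩
    · by_cases hin : i ≤ n
      · simpa [hin] using hp i hin
      · obtain rfl : i = n + 1 := by omega
        simpa using ⟨hr, hy⟩
    · by_cases hin : i < n
      · simpa [hin.le, Nat.succ_le_of_lt hin] using hadj i hin
      · obtain rfl : i = n := by omega
        simpa [hpn] using hzy

/-- Joining the ends of an induced path through a further vertex gives a hole. -/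
theorem hasHole_of_path {p : ℕ → V} {a : V} {m : ℕ} (hm : 2 ≤ m)
    (hinj : ∀ i ≤ m, ∀ j ≤ m, p i = p j → i = j)
    (hp : ∀ i ≤ m, ∀ j ≤ m, (G.Adj (p i) (p j) ↔ j = i + 1 ∨ i = j + 1))
    (hne : ∀ i ≤ m, p i ≠ a) (ha : ∀ i ≤ m, (G.Adj a (p i) ↔ i = 0 ∨ i = m)) :
    ∃ f, G.IsHoleOn (m + 2) f := by
  have hsucc : ∀ i j : Fin (m + 2),
      i = j + 1 ↔ i.val = j.val + 1 ∨ i.val = 0 ∧ j.val = m + 1 := by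
    intro i j
    rw [Fin.ext_iff, Fin.val_add_one]
    have := i.isLt
    have := j.isLt
    split_ifs with hj
    · rw [hj, Fin.val_last]
      omega
    · have : j.val ≠ m + 1 := fun hc => hj (Fin.ext (by simpa using hc))
      omega
  let f : Fin (m + 2) → V := fun i => if i.val ≤ m then p i.val else a
  have hf : Function.Injective f := by
    intro i j hij
    have := i.isLt
    have := j.isLt
    simp only [f] at hij
    split_ifs at hij with h₁ h₂ h₂
    · exact Fin.ext (hinj _ h₁ _ h₂ hij)
    · exact absurd hij (hne _ h₁)
    · exact absurd hij.symm (hne _ h₂)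
    · exact Fin.ext (by omega)
  have hadj : ∀ i j : Fin (m + 2), G.Adj (f i) (f j) ↔ i = j + 1 ∨ j = i + 1 := by
    intro i j
    have := i.isLt
    have := j.isLt
    rw [hsucc, hsucc]
    simp only [f]
    split_ifs with h₁ h₂ h₂
    · rw [hp _ h₁ _ h₂]
      omega
    · rw [G.adj_comm, ha _ h₁]
      omega
    · rw [ha _ h₂]
      omega
    · exact iff_of_false (fun h => h.ne rfl) (by omega)
  exact ⟨f, by omega, hf, hadj⟩

/-- Two vertices with neighbours in a connected set avoiding both are joined by an induced path
through that set. -/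
theorem exists_induced_path {C : Set V} (hC : (G.induce C).Preconnected) {x y u v : V}
    (hxC : x ∉ C) (hyC : y ∉ C) (hxy : x ≠ y) (hu : u ∈ C) (hxu : G.Adj x u) (hv : v ∈ C)
    (hyv : G.Adj y v) :
    ∃ (n : ℕ) (p : ℕ → V), 2 ≤ n ∧ p 0 = x ∧ p n = y ∧ (∀ i, 0 < i → i < n → p i ∈ C) ∧
      (∀ i ≤ n, ∀ j ≤ n, p i = p j → i = j) ∧
      ∀ i ≤ n, ∀ j ≤ n, (0 < i ∨ j < n) → (0 < j ∨ i < n) →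
        (G.Adj (p i) (p j) ↔ j = i + 1 ∨ i = j + 1) := by
  let H : SimpleGraph V :=
    { Adj := fun a b => G.Adj a b ∧ (a ∈ C ∧ b ∈ C ∨ a ∈ C ∧ (b = x ∨ b = y) ∨
        (a = x ∨ a = y) ∧ b ∈ C)
      symm := ⟨fun a b h => ⟨h.1.symm, by tauto⟩⟩
      loopless := ⟨fun a h => h.1.ne rfl⟩ }
  have hHdef : ∀ a b, H.Adj a b ↔ G.Adj a b ∧ (a ∈ C ∧ b ∈ C ∨ a ∈ C ∧ (b = x ∨ b = y) ∨
        (a = x ∨ a = y) ∧ b ∈ C) := fun _ _ => Iff.rfl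
  have hr : H.Reachable x y := by
    have hxu' : H.Adj x u := ⟨hxu, by simp [hu]⟩
    have hvy' : H.Adj v y := ⟨hyv.symm, by simp [hv]⟩
    have huv : H.Reachable u v := by
      let φ : G.induce C →g H := ⟨Subtype.val, fun {a b} hab => ⟨hab, Or.inl ⟨a.2, b.2⟩⟩⟩
      exact (hC ⟨u, hu⟩ ⟨v, hv⟩).map φ
    exact hxu'.reachable.trans (huv.trans hvy'.reachable)
  obtain ⟨p, hpn, hp, hadj⟩ := exists_geodesic _ y hr rfl
  set n := H.dist x y with hn
  have hp0 : p 0 = x := ((hp 0 (by omega)).1.dist_eq_zero_iff.1 (hp 0 (by omega)).2).symm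
  have hinj : ∀ i ≤ n, ∀ j ≤ n, p i = p j → i = j := fun i hi j hj hij => by
    rw [← (hp i hi).2, hij, (hp j hj).2]
  have hn0 : n ≠ 0 := fun hc => hxy (by rw [← hp0, ← hpn, hc])
  have hn2 : 2 ≤ n := by
    by_contra hc
    have h₁ := hadj 0 (by omega)
    have : 0 + 1 = n := by omega
    rw [this, hp0, hpn, hHdef] at h₁
    tauto
  have hmem : ∀ i, 0 < i → i < n → p i ∈ C := by
    intro i hi hin
    have h₁ := hadj i hin
    have h₂ : p i ≠ x := fun hc => by
      have := hinj i hin.le 0 (by omega) (hc.trans hp0.symm)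
      omega
    have h₃ : p i ≠ y := fun hc => by
      have := hinj i hin.le n le_rfl (hc.trans hpn.symm)
      omega
    rw [hHdef] at h₁
    tauto
  refine ⟨n, p, hn2, hp0, hpn, hmem, hinj, fun i hi j hj h₁ h₂ => ⟨fun hG => ?_, ?_⟩⟩
  · have hij : i ≠ j := by
      rintro rfl
      exact hG.ne rfl
    have hH : H.Adj (p i) (p j) := by
      have hends : ∀ k ≤ n, p k ∈ C ∨ (k = 0 ∧ p k = x) ∨ (k = n ∧ p k = y) := by
        intro k hk
        rcases Nat.eq_zero_or_pos k with rfl | hk0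
        · exact Or.inr (Or.inl ⟨rfl, hp0⟩)
        · rcases Nat.lt_or_ge k n with hkn | hkn
          · exact Or.inl (hmem k hk0 hkn)
          · obtain rfl : k = n := by omega
            exact Or.inr (Or.inr ⟨rfl, hpn⟩)
      refine (hHdef _ _).2 ⟨hG, ?_⟩
      rcases hends i hi with hi' | ⟨hi₁, hi'⟩ | ⟨hi₁, hi'⟩ <;>
        rcases hends j hj with hj' | ⟨hj₁, hj'⟩ | ⟨hj₁, hj'⟩
      all_goals first
        | omega
        | tauto
    have := hH.diff_dist_adj (u := x)
    rw [(hp i hi).2, (hp j hj).2] at this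
    omega
  · rintro (rfl | rfl)
    · exact ((hHdef _ _).1 (hadj i (by omega))).1
    · exact ((hHdef _ _).1 (hadj j (by omega))).1.symm

/-- In a chordal graph, adjacent vertices with neighbours in a connected set have a common
neighbour there. -/
theorem Chordal.exists_common_neighbor (h : G.Chordal) {C : Set V}
    (hC : (G.induce C).Preconnected) {x y u v : V} (hxC : x ∉ C) (hyC : y ∉ C) (hxy : G.Adj x y)
    (hu : u ∈ C) (hxu : G.Adj x u) (hv : v ∈ C) (hyv : G.Adj y v) :
    ∃ z ∈ C, G.Adj x z ∧ G.Adj y z := by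
  obtain ⟨n, p, hn, hp0, hpn, hmem, hinj, hadj⟩ :=
    exists_induced_path hC hxC hyC hxy.ne hu hxu hv hyv
  rcases hn.eq_or_lt with rfl | hn
  · refine ⟨p 1, hmem 1 (by omega) (by omega), ?_, ?_⟩
    · rw [← hp0]
      exact (hadj 0 (by omega) 1 (by omega) (by omega) (by omega)).2 (by omega)
    · rw [← hpn]
      exact (hadj 2 (by omega) 1 (by omega) (by omega) (by omega)).2 (by omega)
  · refine absurd ⟨_, hasHole_of_path (p := p) (a := y) (m := n - 1) (by omega)
      (fun i hi j hj => hinj i (by omega) j (by omega))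
      (fun i hi j hj => hadj i (by omega) j (by omega) (by omega) (by omega))
      (fun i hi hc => ?_) (fun i hi => ?_)⟩ h
    · have := hinj i (by omega) n le_rfl (hc.trans hpn.symm)
      omega
    · rcases Nat.eq_zero_or_pos i with rfl | hi0
      · simpa [hp0] using hxy.symm
      · rw [← hpn, hadj n le_rfl i (by omega) (by omega) (by omega)]
        omega

/-- In a chordal graph, vertices with neighbours in a connected set and a common neighbour that
has none in that set are adjacent. -/
theorem Chordal.adj_of_connected (h : G.Chordal) {C : Set V}
    (hC : (G.induce C).Preconnected) {a x y u v : V} (hxC : x ∉ C) (hyC : y ∉ C) (hxy : x ≠ y)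
    (hu : u ∈ C) (hxu : G.Adj x u) (hv : v ∈ C) (hyv : G.Adj y v) (haC : a ∉ C)
    (hax : G.Adj a x) (hay : G.Adj a y) (ha : ∀ c ∈ C, ¬ G.Adj a c) : G.Adj x y := by
  by_contra hnadj
  obtain ⟨n, p, hn, hp0, hpn, hmem, hinj, hadj⟩ :=
    exists_induced_path hC hxC hyC hxy hu hxu hv hyv
  refine h ⟨_, hasHole_of_path (p := p) (a := a) hn hinj (fun i hi j hj => ?_)
    (fun i hi hc => ?_) (fun i hi => ?_)⟩
  · by_cases hc : (0 < i ∨ j < n) ∧ (0 < j ∨ i < n)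
    · exact hadj i hi j hj hc.1 hc.2
    · rcases (by omega : i = 0 ∧ j = n ∨ i = n ∧ j = 0) with ⟨rfl, rfl⟩ | ⟨rfl, rfl⟩
      · rw [hp0, hpn]
        exact iff_of_false hnadj (by omega)
      · rw [hp0, hpn, G.adj_comm]
        exact iff_of_false hnadj (by omega)
  · rcases (by omega : i = 0 ∨ i = n ∨ 0 < i ∧ i < n) with rfl | rfl | ⟨h₁, h₂⟩
    · exact hax.ne (hc.symm.trans hp0)
    · exact hay.ne (hc.symm.trans hpn)
    · exact haC (hc ▸ hmem i h₁ h₂)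
  · rcases (by omega : i = 0 ∨ i = n ∨ 0 < i ∧ i < n) with rfl | rfl | ⟨h₁, h₂⟩
    · simpa [hp0] using hax
    · simpa [hpn] using hay
    · exact iff_of_false (ha _ (hmem i h₁ h₂)) (by omega)

/-- An end vertex: a simplicial vertex that is not the nose of a bull. -/
def IsEnd (G : SimpleGraph V) (a : V) : Prop :=
  (∀ ⦃x y⦄, G.Adj a x → G.Adj a y → x ≠ y → G.Adj x y) ∧
  ∀ ⦃x x' y y'⦄, G.Adj a x → G.Adj a x' → y ≠ a → y' ≠ a → ¬ G.Adj a y → ¬ G.Adj a y' →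
    G.Adj x y → G.Adj x' y' → ¬ G.Adj x y' → ¬ G.Adj x' y → y ≠ y' → G.Adj y y'

theorem exists_isEnd [Finite V] (hconn : G.Connected) (hclaw : G.ClawFree) (htent : G.TentFree)
    (hchord : G.Chordal) : ∃ a, G.IsEnd a := by
  classical
  let P : V × Set V → Prop := fun q => q.2.Nonempty ∧ (G.induce q.2).Preconnected ∧
    q.1 ∉ q.2 ∧ ∀ c ∈ q.2, ¬ G.Adj q.1 c
  by_cases hP : ∃ q, P q
  swap
  · have hall : ∀ a b, a ≠ b → G.Adj a b := by
      intro a b hab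
      by_contra hnadj
      refine hP ⟨(a, {b}), Set.singleton_nonempty b, ?_, hab, by simpa using hnadj⟩
      exact fun x y => by
        obtain rfl : x = y := Subsingleton.elim _ _
        exact Reachable.refl _
    obtain ⟨a⟩ := hconn.nonempty
    exact ⟨a, fun x y _ _ hxy => hall x y hxy, fun x x' y y' _ _ _ _ _ _ _ _ _ _ hne =>
      hall y y' hne⟩
  obtain ⟨⟨a, C⟩, ⟨hne, hC, haC, hnadj⟩, hmax⟩ :=
    Set.exists_max_image {q | P q} (fun q => q.2.ncard) (Set.toFinite _) hP
  simp only at hne hC haC hnadj hmax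
  -- every boundary vertex of `C` sees every vertex away from `C`
  have hbd : ∀ z, z ∉ C → (∀ c ∈ C, ¬ G.Adj z c) → ∀ w, w ∉ C → ∀ c ∈ C, G.Adj w c →
      G.Adj z w := by
    intro z hzC hz w hw c hc hwc
    by_contra hzw
    have hwz : z ≠ w := fun e => hz c hc (e ▸ hwc)
    have hconn' : (G.induce (C ∪ {w, c})).Preconnected :=
      (induce_union_connected hC (induce_pair_connected_of_adj hwc).preconnected
        ⟨c, hc, by simp⟩).preconnected
    have := hmax (z, C ∪ {w, c}) ⟨⟨c, Or.inl hc⟩, hconn', ?_, ?_⟩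
    · have hlt : C.ncard < (C ∪ {w, c}).ncard := by
        refine Set.ncard_lt_ncard ⟨Set.subset_union_left, fun hsub => hw (hsub ?_)⟩
          (Set.toFinite _)
        simp
      simp only at this
      omega
    · rintro (h₁ | h₁ | h₁)
      · exact hzC h₁
      · exact hwz h₁
      · exact hzC ((show z = c from h₁) ▸ hc)
    · rintro d (h₁ | rfl | rfl)
      · exact hz d h₁
      · exact hzw
      · exact hz d hc
  obtain ⟨s, c₀, hs, hc₀, hsc₀⟩ : ∃ s c, s ∉ C ∧ c ∈ C ∧ G.Adj s c := by
    by_contra! hno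
    obtain ⟨c, hc⟩ := hne
    obtain ⟨p⟩ := hconn.preconnected c a
    obtain ⟨d, -, h₁, h₂⟩ := p.exists_boundary_dart C hc haC
    exact hno d.snd d.fst h₂ h₁ d.adj.symm
  have hsimp : ∀ ⦃x y⦄, G.Adj a x → G.Adj a y → x ≠ y → G.Adj x y := by
    intro x y hax hay hxy
    have hxC : x ∉ C := fun hc => hnadj x hc hax
    have hyC : y ∉ C := fun hc => hnadj y hc hay
    by_cases hx : ∃ c ∈ C, G.Adj x c <;> by_cases hy : ∃ c ∈ C, G.Adj y c
    · obtain ⟨u, hu, hxu⟩ := hx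
      obtain ⟨v, hv, hyv⟩ := hy
      exact hchord.adj_of_connected hC hxC hyC hxy hu hxu hv hyv haC hax hay hnadj
    · obtain ⟨u, hu, hxu⟩ := hx
      push Not at hy
      exact (hbd y hyC hy x hxC u hu hxu).symm
    · obtain ⟨v, hv, hyv⟩ := hy
      push Not at hx
      exact hbd x hxC hx y hyC v hv hyv
    · push Not at hx hy
      by_contra hnxy
      have h₁ := (hbd x hxC hx s hs c₀ hc₀ hsc₀).symm
      have h₂ := (hbd y hyC hy s hs c₀ hc₀ hsc₀).symm
      exact hclaw h₁ h₂ hsc₀ hxy (fun e => hxC (e ▸ hc₀)) (fun e => hyC (e ▸ hc₀)) hnxy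
        (hx c₀ hc₀) (hy c₀ hc₀)
  have hcover : ∀ y, y ≠ a → ¬ G.Adj a y → y ∈ C := by
    intro y hya hay
    by_contra hyC
    by_cases hy : ∃ c ∈ C, G.Adj y c
    · obtain ⟨c, hc, hyc⟩ := hy
      exact hay (hbd a haC hnadj y hyC c hc hyc)
    · push Not at hy
      have h₁ := (hbd y hyC hy s hs c₀ hc₀ hsc₀).symm
      have h₂ := (hbd a haC hnadj s hs c₀ hc₀ hsc₀).symm
      exact hclaw h₂ h₁ hsc₀ hya.symm (fun e => haC (e ▸ hc₀)) (fun e => hyC (e ▸ hc₀)) hay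
        (hnadj c₀ hc₀) (hy c₀ hc₀)
  refine ⟨a, hsimp, fun x x' y y' hax hax' hya hya' hay hay' hxy hxy' hnxy' hnxy hne => ?_⟩
  by_contra hnyy
  have hyC := hcover y hya hay
  have hyC' := hcover y' hya' hay'
  have hxC : x ∉ C := fun hc => hnadj x hc hax
  have hxC' : x' ∉ C := fun hc => hnadj x' hc hax'
  have hxx : G.Adj x x' := hsimp hax hax' fun e => hnxy' (e ▸ hxy')
  obtain ⟨z, hz, hxz, hxz'⟩ := hchord.exists_common_neighbor hC hxC hxC' hxx hyC hxy hyC' hxy'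
  -- the neighbours in `C` of a neighbour of `a` form a clique
  have hclique : ∀ w, G.Adj a w → ∀ b ∈ C, ∀ c ∈ C, G.Adj w b → G.Adj w c → b ≠ c →
      G.Adj b c := by
    intro w haw b hb c hc hwb hwc hbc
    by_contra hnbc
    exact hclaw haw.symm hwb hwc (fun e => haC (e ▸ hb)) (fun e => haC (e ▸ hc)) hbc (hnadj b hb)
      (hnadj c hc) hnbc
  have hzy : G.Adj z y := hclique x hax z hz y hyC hxz hxy fun e => hnxy (e ▸ hxz')
  have hzy' : G.Adj z y' := hclique x' hax' z hz y' hyC' hxz' hxy' fun e => hnxy' (e ▸ hxz)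
  exact htent hxx hxz hxz' hxy hax.symm hxy' hax'.symm hzy' hzy hnxy' hnxy
    (fun e => hnadj z hz e.symm) (fun e => hnyy e.symm) (fun e => hay' e.symm)
    (fun e => hay e.symm)

theorem IsEnd.layer_clique (hconn : G.Connected) (hclaw : G.ClawFree) (hsq : G.SquareFree)
    (hnet : G.NetFree) {a : V} (ha : G.IsEnd a) (n : ℕ) :
    ∀ u v, G.dist a u = n → G.dist a v = n → u ≠ v → G.Adj u v := by
  have hnonadj : ∀ {z w : V} {i j : ℕ}, G.dist a z = i → G.dist a w = j → i + 2 ≤ j →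
      ¬ G.Adj z w := by
    intro z w i j hz hw hij hadj
    have := hadj.diff_dist_adj (u := a)
    omega
  have hneq : ∀ {z w : V} {i j : ℕ}, G.dist a z = i → G.dist a w = j → i ≠ j → z ≠ w := by
    rintro z w i j hz hw hij rfl
    exact hij (hz.symm.trans hw)
  have ha0 : G.dist a a = 0 := dist_self
  induction n using Nat.strong_induction_on with
  | _ n ih =>
  intro y y' hy hy' hne
  by_contra hnyy
  rcases n with - | n
  · rw [hconn.dist_eq_zero_iff] at hy hy'
    exact hne (hy.symm.trans hy')
  obtain ⟨x, hxy, -, hx⟩ := exists_adj_dist_eq (hconn a y) hy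
  obtain ⟨x', hxy', -, hx'⟩ := exists_adj_dist_eq (hconn a y') hy'
  rcases n with - | m
  · rw [hconn.dist_eq_zero_iff] at hx hx'
    subst hx hx'
    exact hnyy (ha.1 hxy hxy' hne)
  obtain ⟨z, hzx, -, hz⟩ := exists_adj_dist_eq (hconn a x) hx
  obtain ⟨z', hzx', -, hz'⟩ := exists_adj_dist_eq (hconn a x') hx'
  have hcommon : ∀ {w t : V}, G.dist a w = m + 1 → G.dist a t = m → G.Adj t w →
      G.Adj w y → ¬ G.Adj w y' := by
    intro w t hw ht htw hwy hwy'
    exact hclaw htw.symm hwy hwy' (hneq ht hy (by omega)) (hneq ht hy' (by omega)) hne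
      (hnonadj ht hy (by omega)) (hnonadj ht hy' (by omega)) hnyy
  have hnxy' : ¬ G.Adj x y' := hcommon hx hz hzx hxy
  have hnxy : ¬ G.Adj x' y := fun hc => hcommon hx' hz' hzx' hc hxy'
  have hxx : G.Adj x x' := ih _ (by omega) x x' hx hx' fun e => hnxy' (e ▸ hxy')
  obtain ⟨t, ht, htx, htx'⟩ : ∃ t, G.dist a t = m ∧ G.Adj t x ∧ G.Adj t x' := by
    by_contra hno
    have h₁ : ¬ G.Adj z x' := fun hc => hno ⟨z, hz, hzx, hc⟩
    have h₂ : ¬ G.Adj z' x := fun hc => hno ⟨z', hz', hc, hzx'⟩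
    have h₃ : z ≠ z' := fun e => h₁ (e ▸ hzx')
    exact hsq hzx hxx hzx'.symm (ih m (by omega) z z' hz hz' h₃) (hneq hz hx' (by omega))
      (hneq hx hz' (by omega)) h₁ fun hc => h₂ hc.symm
  rcases m with - | m
  · obtain rfl := hconn.dist_eq_zero_iff.1 ht
    exact hnyy (ha.2 htx htx' (hneq hy ha0 (by omega)) (hneq hy' ha0 (by omega))
      (hnonadj ha0 hy (by omega)) (hnonadj ha0 hy' (by omega)) hxy hxy' hnxy' hnxy hne)
  · obtain ⟨w, hwt, -, hw⟩ := exists_adj_dist_eq (hconn a t) ht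
    exact hnet htx htx' hxx hwt.symm hxy hxy' (hnonadj ht hy (by omega))
      (hnonadj ht hy' (by omega)) (fun e => hnonadj hw hx (by omega) e.symm) hnxy'
      (fun e => hnonadj hw hx' (by omega) e.symm) hnxy (hnonadj hw hy (by omega))
      (hnonadj hw hy' (by omega)) hnyy

end SimpleGraph

namespace SimpleGraph

variable {V : Type*} {G : SimpleGraph V}

theorem isCoarseLayout_of_layers {a : V} (hclique : ∀ n u v, G.dist a u = n → G.dist a v = n →
    u ≠ v → G.Adj u v) :
    G.IsCoarseLayout fun u v d => 2 * G.dist a v = 2 * G.dist a u + d where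
  refl u := rfl
  eq_zero u m h _ := by simpa using h
  trans u v w i j h₁ h₂ := by omega
  left v x y i j h₁ h₂ h := by omega
  right v x y i j h₁ h₂ h := by omega
  adj_of_le_one u v d h hd huv := hclique _ u v rfl (by omega) huv
  offset_of_adj u v h := by
    have := h.diff_dist_adj (u := a)
    obtain h₁ | h₁ | h₁ : G.dist a v = G.dist a u ∨ G.dist a v = G.dist a u + 1 ∨
        G.dist a u = G.dist a v + 1 := by omega
    · exact ⟨0, by omega, by omega⟩
    · exact ⟨2, by omega, by omega⟩
    · exact ⟨2, by omega, by omega⟩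
  adj_one_three v x y h₁ := by omega
  adj_one_three' v x y h₁ := by omega

theorem Chordal.exists_isCoarseLayout [Finite V] (hchord : G.Chordal) (hconn : G.Connected)
    (hclaw : G.ClawFree) (hsq : G.SquareFree) (hnet : G.NetFree) (htent : G.TentFree) :
    ∃ Q, G.IsCoarseLayout Q := by
  obtain ⟨a, ha⟩ := exists_isEnd hconn hclaw htent hchord
  exact ⟨_, isCoarseLayout_of_layers (ha.layer_clique hconn hclaw hsq hnet)⟩

end SimpleGraph

namespace SimpleGraph

variable {V : Type*} {G : SimpleGraph V} {k : ℕ} {e : ZMod k} {f : ZMod k → V}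

/-- No vertex is adjacent to all vertices of a hole of length five. -/
def WheelFree (G : SimpleGraph V) : Prop :=
  ∀ ⦃f : ZMod 5 → V⦄, G.IsHoleOn 5 f → ∀ v, ¬ ∀ i, G.Adj v (f i)

theorem wheelFree_of_not_hasInducedCopy (h : ¬ G.HasInducedCopy (wheelG 5)) : G.WheelFree := by
  rintro f ⟨-, hinj, hadj⟩ v hv
  refine h ⟨fun x => x.elim v f, ?_, ?_⟩
  · rintro (_ | i) (_ | j) hij
    · rfl
    · exact absurd hij (hv j).ne
    · exact absurd hij (hv i).ne'
    · exact congrArg some (hinj hij)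
  · rintro (_ | i) (_ | j)
    · simp
    · simpa [wheelG] using hv j
    · simpa [wheelG] using (hv i).symm
    · have : i = j + 1 ∨ j = i + 1 → i ≠ j := by
        rintro hij rfl
        exact absurd hij (by revert i; decide)
      simpa [wheelG, hadj] using this

/-- A hole of minimum length, which is at least five. The generator of the cyclic order is named,
so that computations with indices are symbolic. -/
structure IsMinHole (G : SimpleGraph V) (e : ZMod k) (f : ZMod k → V) : Prop where
  eq_one : e = 1
  isHoleOn : G.IsHoleOn k f
  le : ∀ ⦃m⦄ ⦃g : ZMod m → V⦄, G.IsHoleOn m g → k ≤ m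
  five_le : 5 ≤ k

/-- Adjacency or equality with a vertex of the hole. -/
def Sees (G : SimpleGraph V) (f : ZMod k → V) (v : V) (i : ZMod k) : Prop :=
  v = f i ∨ G.Adj v (f i)

theorem exists_isMinHole (hsq : G.SquareFree) (h : G.HasHole) :
    ∃ (k : ℕ) (e : ZMod k) (f : ZMod k → V), G.IsMinHole e f := by
  classical
  obtain ⟨f, hf⟩ := Nat.find_spec h
  refine ⟨_, 1, f, rfl, hf, fun m g hg => Nat.find_min' h ⟨g, hg⟩, ?_⟩
  by_contra hlt
  generalize Nat.find h = k at f hf hlt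
  obtain rfl : k = 4 := by
    have := hf.1
    omega
  obtain ⟨-, hinj, hadj⟩ := hf
  exact hsq ((hadj 0 1).2 (by decide)) ((hadj 1 2).2 (by decide)) ((hadj 2 3).2 (by decide))
    ((hadj 0 3).2 (by decide)) (hinj.ne (by decide)) (hinj.ne (by decide))
    (mt (hadj 0 2).1 (by decide)) (mt (hadj 1 3).1 (by decide))

theorem natCast_zmod_ne_zero {k n : ℕ} (hn : 0 < n) (hk : n < k) : (n : ZMod k) ≠ 0 := by
  rw [Ne, ZMod.natCast_eq_zero_iff]
  exact Nat.not_dvd_of_pos_of_lt hn hk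

namespace IsMinHole

theorem mul_ne_zero (h : G.IsMinHole e f) {n : ℕ} (h₀ : 0 < n) (hn : n < k) :
    (n : ZMod k) * e ≠ 0 := by
  rw [h.eq_one, mul_one]
  exact natCast_zmod_ne_zero h₀ hn

theorem ne_zero (h : G.IsMinHole e f) : e ≠ 0 ∧ 2 * e ≠ 0 ∧ 3 * e ≠ 0 ∧ 4 * e ≠ 0 := by
  have := h.five_le
  exact ⟨by simpa using h.mul_ne_zero (n := 1) (by omega) (by omega),
    mod_cast h.mul_ne_zero (n := 2) (by omega) (by omega),
    mod_cast h.mul_ne_zero (n := 3) (by omega) (by omega),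
    mod_cast h.mul_ne_zero (n := 4) (by omega) (by omega)⟩

theorem adj_iff (h : G.IsMinHole e f) (i j : ZMod k) :
    G.Adj (f i) (f j) ↔ i = j + e ∨ j = i + e := by
  rw [h.eq_one]
  exact h.isHoleOn.2.2 i j

theorem injective (h : G.IsMinHole e f) : Function.Injective f := h.isHoleOn.2.1

theorem adj_add (h : G.IsMinHole e f) (i : ZMod k) : G.Adj (f i) (f (i + e)) :=
  (h.adj_iff _ _).2 (Or.inr rfl)

theorem adj_sub (h : G.IsMinHole e f) (i : ZMod k) : G.Adj (f i) (f (i - e)) :=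
  (h.adj_iff _ _).2 (Or.inl (by ring))

theorem sees_self_iff (h : G.IsMinHole e f) (i j : ZMod k) :
    G.Sees f (f i) j ↔ j = i - e ∨ j = i ∨ j = i + e := by
  rw [Sees, h.adj_iff, h.injective.eq_iff]
  grind

theorem sees_pred_or_succ (h : G.IsMinHole e f) (hclaw : G.ClawFree) {v : V} {i : ZMod k}
    (hi : G.Sees f v i) : G.Sees f v (i - e) ∨ G.Sees f v (i + e) := by
  rcases hi with rfl | hi
  · exact Or.inl (Or.inr (h.adj_sub i))
  by_contra! hno
  obtain ⟨h1, h2, h3, h4⟩ := h.ne_zero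
  simp only [Sees, not_or] at hno
  exact hclaw (h.adj_sub i) (h.adj_add i) hi.symm
    (h.injective.ne (by grind)) (Ne.symm hno.1.1) (Ne.symm hno.2.1) (by rw [h.adj_iff]; grind)
    (fun e => hno.1.2 e.symm) (fun e => hno.2.2 e.symm)

theorem sees_of_pred_of_succ (h : G.IsMinHole e f) (hsq : G.SquareFree) {v : V} {i : ZMod k}
    (h₁ : G.Sees f v (i - e)) (h₂ : G.Sees f v (i + e)) : G.Sees f v i := by
  obtain ⟨h1, h2, h3, h4⟩ := h.ne_zero
  rcases h₁ with rfl | h₁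
  · exact Or.inr (h.adj_sub i).symm
  rcases h₂ with rfl | h₂
  · exact Or.inr (h.adj_add i).symm
  by_contra hno
  simp only [Sees, not_or] at hno
  exact hsq h₁ (h.adj_sub i).symm (h.adj_add i) h₂ hno.1
    (h.injective.ne (by grind)) hno.2 (by rw [h.adj_iff]; grind)

theorem not_sees_four (h : G.IsMinHole e f) (hclaw : G.ClawFree) (hsq : G.SquareFree)
    (hwheel : G.WheelFree) {v : V} {i : ZMod k} (h₀ : G.Sees f v i) (h₁ : G.Sees f v (i + e))
    (h₂ : G.Sees f v (i + 2 * e)) : ¬ G.Sees f v (i + 3 * e) := by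
  intro h₃
  obtain ⟨h1, h2, h3, h4⟩ := h.ne_zero
  have hoff : ∀ j, v ≠ f j := by
    rintro j rfl
    rw [h.sees_self_iff] at h₀ h₁ h₂ h₃
    grind
  have hsees : ∀ j, G.Sees f v j ↔ G.Adj v (f j) := fun j => or_iff_right (hoff j)
  rcases h.five_le.eq_or_lt with rfl | h6
  · have h₄ : G.Sees f v (i + 4 * e) := by
      have h₅ : i + 4 * e + e = i := by
        rw [add_assoc, show 4 * e + e = (5 : ZMod 5) * e by ring, show (5 : ZMod 5) = 0 from rfl]
        ring
      exact h.sees_of_pred_of_succ hsq (by convert h₃ using 1; ring) (by rwa [h₅])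
    refine hwheel h.isHoleOn v fun j => ?_
    rw [← hsees]
    have : j = i ∨ j = i + e ∨ j = i + 2 * e ∨ j = i + 3 * e ∨ j = i + 4 * e := by
      rw [h.eq_one]
      clear * -
      revert i j
      decide
    rcases this with rfl | rfl | rfl | rfl | rfl <;> assumption
  · have h5 : 5 * e ≠ 0 := mod_cast h.mul_ne_zero (n := 5) (by omega) h6
    have hiff := h.adj_iff
    have hinj := h.injective
    simp only [hsees] at h₀ h₁ h₂ h₃
    have hother : ∀ j, G.Adj v (f j) → j = i ∨ j = i + e ∨ j = i + 2 * e ∨ j = i + 3 * e := by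
      intro j hj
      by_contra! hne
      by_cases hj1 : j = i - e
      · subst hj1
        exact hclaw hj h₁ h₃ (hinj.ne (by grind)) (hinj.ne (by grind)) (hinj.ne (by grind))
          (by rw [hiff]; grind) (by rw [hiff]; grind) (by rw [hiff]; grind)
      · exact hclaw hj h₀ h₂ (hinj.ne (by grind)) (hinj.ne (by grind)) (hinj.ne (by grind))
          (by rw [hiff]; grind) (by rw [hiff]; grind) (by rw [hiff]; grind)
    obtain rfl := h.eq_one
    have hcast : ∀ {a b : ℕ}, a < k → b < k → (a : ZMod k) = b → a = b := by
      intro a b ha hb hab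
      rwa [ZMod.natCast_eq_natCast_iff', Nat.mod_eq_of_lt ha, Nat.mod_eq_of_lt hb] at hab
    have hk : ((k - 3 : ℕ) : ZMod k) = -3 := by
      rw [Nat.cast_sub (by omega)]
      simp
    suffices hex : ∃ g, G.IsHoleOn (k - 3 + 2) g by
      obtain ⟨g, hg⟩ := hex
      have := h.le hg
      omega
    refine hasHole_of_path (p := fun j : ℕ => f (i + 3 + j)) (a := v) (by omega) ?_ ?_ ?_ ?_
    · intro a ha b hb hab
      exact hcast (by omega) (by omega) (add_left_cancel (hinj hab))
    · intro a ha b hb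
      simp only [hiff]
      constructor
      · rintro (hab | hab)
        · right
          exact hcast (by omega) (by omega) (by push_cast; linear_combination hab)
        · left
          exact hcast (by omega) (by omega) (by push_cast; linear_combination hab)
      · rintro (rfl | rfl) <;> push_cast <;> grind
    · exact fun a ha e => hoff _ e.symm
    · intro a ha
      constructor
      · intro hadj
        rcases hother _ hadj with e | e | e | e
        · right
          exact hcast (by omega) (by omega) (by rw [hk]; linear_combination e)
        · have : a = k - 2 := hcast (by omega) (by omega) (by
            rw [Nat.cast_sub (by omega)]; push_cast; simp; linear_combination e)
          omega
        · have : a = k - 1 := hcast (by omega) (by omega) (by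
            rw [Nat.cast_sub (by omega)]; push_cast; simp; linear_combination e)
          omega
        · left
          exact hcast (by omega) (by omega) (by push_cast; linear_combination e)
      · rintro (rfl | rfl)
        · simpa using h₃
        · simpa [hk] using h₀

end IsMinHole

end SimpleGraph

namespace SimpleGraph

variable {V : Type*} {G : SimpleGraph V} {k : ℕ} {e : ZMod k} {f : ZMod k → V}

/-- The vertex `v` behaves like the vertex `f i` of the hole `f`. -/
def IsAt (G : SimpleGraph V) (e : ZMod k) (f : ZMod k → V) (v : V) (i : ZMod k) : Prop :=
  ∀ j, G.Sees f v j ↔ j = i - e ∨ j = i ∨ j = i + e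

/-- The vertex `v` behaves like the midpoint of `f i` and the next vertex of the hole `f`. -/
def IsAfter (G : SimpleGraph V) (e : ZMod k) (f : ZMod k → V) (v : V) (i : ZMod k) : Prop :=
  ∀ j, G.Sees f v j ↔ j = i ∨ j = i + e

namespace IsMinHole

theorem isAt_self (h : G.IsMinHole e f) (i : ZMod k) : G.IsAt e f (f i) i := h.sees_self_iff i

theorem ne_of_isAfter (h : G.IsMinHole e f) {v : V} {i : ZMod k} (hv : G.IsAfter e f v i)
    (j : ZMod k) : v ≠ f j := by
  rintro rfl
  obtain ⟨h1, h2, h3, h4⟩ := h.ne_zero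
  have h₁ := hv j
  have h₂ := hv (j - e)
  have h₃ := hv (j + e)
  rw [h.sees_self_iff] at h₁ h₂ h₃
  grind

theorem adj_iff_of_isAfter (h : G.IsMinHole e f) {v : V} {i : ZMod k} (hv : G.IsAfter e f v i)
    (j : ZMod k) : G.Adj v (f j) ↔ j = i ∨ j = i + e := by
  rw [← hv j, Sees, or_iff_right (h.ne_of_isAfter hv j)]

theorem ne_of_isAt (h : G.IsMinHole e f) {v : V} {i j : ZMod k} (hv : G.IsAt e f v i)
    (hij : j ≠ i) : v ≠ f j := by
  rintro rfl
  obtain ⟨h1, h2, h3, h4⟩ := h.ne_zero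
  have h₁ := hv j
  have h₂ := hv (j - e)
  have h₃ := hv (j + e)
  rw [h.sees_self_iff] at h₁ h₂ h₃
  grind

theorem adj_iff_of_isAt (h : G.IsMinHole e f) {v : V} {i j : ZMod k} (hv : G.IsAt e f v i)
    (hij : j ≠ i) : G.Adj v (f j) ↔ j = i - e ∨ j = i + e := by
  have := hv j
  rw [Sees, or_iff_right (h.ne_of_isAt hv hij)] at this
  rw [this]
  simp [hij]

theorem exists_isAt_or_isAfter_of_sees (h : G.IsMinHole e f) (hclaw : G.ClawFree)
    (hsq : G.SquareFree) (hnet : G.NetFree) (hwheel : G.WheelFree) {v : V}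
    (hv : ∃ i, G.Sees f v i) : ∃ i, G.IsAt e f v i ∨ G.IsAfter e f v i := by
  by_cases hon : ∃ j, v = f j
  · obtain ⟨j, rfl⟩ := hon
    exact ⟨j, Or.inl (h.isAt_self j)⟩
  push Not at hon
  have hsees : ∀ j, G.Sees f v j ↔ G.Adj v (f j) := fun j => or_iff_right (hon j)
  obtain ⟨h1, h2, h3, h4⟩ := h.ne_zero
  have hiff := h.adj_iff
  have hinj := h.injective
  have hfour : ∀ i, G.Adj v (f i) → G.Adj v (f (i + e)) → G.Adj v (f (i + 2 * e)) →
      ¬ G.Adj v (f (i + 3 * e)) := by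
    simpa only [hsees] using fun i => h.not_sees_four hclaw hsq hwheel (v := v) (i := i)
  have hgap : ∀ i, G.Adj v (f (i - e)) → G.Adj v (f (i + e)) → G.Adj v (f i) := by
    simpa only [hsees] using fun i => h.sees_of_pred_of_succ hsq (v := v) (i := i)
  have hext : ∀ i, G.Adj v (f i) → G.Adj v (f (i - e)) ∨ G.Adj v (f (i + e)) := by
    simpa only [hsees] using fun i => h.sees_pred_or_succ hclaw (v := v) (i := i)
  simp only [hsees] at hv
  obtain ⟨i, hi, hi'⟩ : ∃ i, G.Adj v (f i) ∧ ¬ G.Adj v (f (i - e)) := by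
    by_contra! hno
    obtain ⟨i, hi⟩ := hv
    have hi1 := hno _ hi
    have hi2 := hno _ hi1
    have hi3 := hno _ hi2
    refine hfour _ hi3 ?_ ?_ ?_
    · convert hi2 using 2; ring
    · convert hi1 using 2; ring
    · convert hi using 2; ring
  have hi1 := (hext i hi).resolve_left hi'
  by_cases hi2 : G.Adj v (f (i + 2 * e))
  · refine ⟨i + e, Or.inl fun j => ?_⟩
    rw [hsees]
    constructor
    · intro hj
      by_contra! hne
      by_cases hj3 : j = i + 3 * e
      · exact hfour i hi hi1 hi2 (hj3 ▸ hj)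
      have hj0 : j ≠ i - e := by
        rintro rfl
        exact hi' hj
      exact hclaw hi hi2 hj (hinj.ne (by grind)) (hinj.ne (by grind)) (hinj.ne (by grind))
        (by rw [hiff]; grind) (by rw [hiff]; grind) (by rw [hiff]; grind)
    · rintro (rfl | rfl | rfl)
      · simpa using hi
      · exact hi1
      · convert hi2 using 2; ring
  · refine ⟨i, Or.inr fun j => ?_⟩
    rw [hsees]
    refine ⟨fun hj => ?_, by rintro (rfl | rfl) <;> assumption⟩
    by_contra! hne
    have hj0 : j ≠ i - e := by
      rintro rfl
      exact hi' hj
    have hj2 : j ≠ i + 2 * e := by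
      rintro rfl
      exact hi2 hj
    have hj3 : j ≠ i + 3 * e := by
      rintro rfl
      refine hi2 (hgap _ ?_ ?_)
      · convert hi1 using 2; ring
      · convert hj using 2; ring
    have hj4 : j ≠ i - 2 * e := by
      rintro rfl
      refine hi' (hgap _ ?_ ?_)
      · convert hj using 2; ring
      · convert hi using 2; ring
    exact hnet hi hi1 (h.adj_add i) hj (h.adj_sub i)
      ((hiff (i + e) (i + 2 * e)).2 (by grind)) hi' hi2 (by rw [hiff]; grind)
      (by rw [hiff]; grind) (by rw [hiff]; grind) (by rw [hiff]; grind) (by rw [hiff]; grind)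
      (by rw [hiff]; grind) (by rw [hiff]; grind)

theorem exists_isAt_or_isAfter (h : G.IsMinHole e f) (hconn : G.Connected) (hclaw : G.ClawFree)
    (hsq : G.SquareFree) (hnet : G.NetFree) (hwheel : G.WheelFree) (v : V) :
    ∃ i, G.IsAt e f v i ∨ G.IsAfter e f v i := by
  refine h.exists_isAt_or_isAfter_of_sees hclaw hsq hnet hwheel ?_
  by_contra hv
  obtain ⟨p⟩ := hconn.preconnected (f 0) v
  obtain ⟨⟨⟨u, w⟩, huw⟩, -, hu, hw⟩ :=
    p.exists_boundary_dart {v | ∃ i, G.Sees f v i} ⟨0, Or.inl rfl⟩ hv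
  simp only [Set.mem_ofPred_eq, not_exists, Sees, not_or] at huw hu hw
  obtain ⟨h1, h2, h3, h4⟩ := h.ne_zero
  have hiff := h.adj_iff
  have hinj := h.injective
  have hon : ∀ j, u ≠ f j := fun j hj => (hw j).2 (hj ▸ huw.symm)
  obtain ⟨i, hi | hi⟩ := h.exists_isAt_or_isAfter_of_sees hclaw hsq hnet hwheel hu
  · have hadj : ∀ j, G.Adj u (f j) ↔ j = i - e ∨ j = i ∨ j = i + e := fun j => by
      rw [← hi j, Sees, or_iff_right (hon j)]
    exact hclaw huw ((hadj (i - e)).2 (by simp)) ((hadj (i + e)).2 (by simp)) (hw _).1 (hw _).1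
      (hinj.ne (by grind)) (hw _).2 (hw _).2 (by rw [hiff]; grind)
  · have hadj := h.adj_iff_of_isAfter hi
    exact hnet ((hadj i).2 (by simp)) ((hadj (i + e)).2 (by simp)) (h.adj_add i) huw
      (h.adj_sub i) ((hiff (i + e) (i + 2 * e)).2 (by grind)) (by rw [hadj]; grind)
      (by rw [hadj]; grind) (fun hc => (hw _).2 hc.symm) (by rw [hiff]; grind)
      (fun hc => (hw _).2 hc.symm) (by rw [hiff]; grind) (hw _).2 (hw _).2 (by rw [hiff]; grind)

theorem adj_of_isAt_of_isAt (h : G.IsMinHole e f) (hsq : G.SquareFree) {u v : V} {i : ZMod k}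
    (hu : G.IsAt e f u i) (hv : G.IsAt e f v i) (huv : u ≠ v) : G.Adj u v := by
  obtain ⟨h1, h2, h3, h4⟩ := h.ne_zero
  by_cases hui : u = f i
  · have := (hv i).2 (by simp)
    rw [Sees, ← hui] at this
    exact (this.resolve_left huv.symm).symm
  by_cases hvi : v = f i
  · have := (hu i).2 (by simp)
    rw [Sees, ← hvi] at this
    exact this.resolve_left huv
  by_contra hnadj
  exact hsq ((h.adj_iff_of_isAt hu (j := i - e) (by grind)).2 (by simp))
    ((h.adj_iff_of_isAt hv (j := i - e) (by grind)).2 (by simp)).symm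
    ((h.adj_iff_of_isAt hv (j := i + e) (by grind)).2 (by simp))
    ((h.adj_iff_of_isAt hu (j := i + e) (by grind)).2 (by simp)) huv
    (h.injective.ne (by grind)) hnadj (by rw [h.adj_iff]; grind)

theorem adj_of_isAfter_of_isAfter (h : G.IsMinHole e f) (hclaw : G.ClawFree) {u v : V}
    {i : ZMod k} (hu : G.IsAfter e f u i) (hv : G.IsAfter e f v i) (huv : u ≠ v) :
    G.Adj u v := by
  obtain ⟨h1, h2, h3, h4⟩ := h.ne_zero
  have hu' := h.adj_iff_of_isAfter hu
  have hv' := h.adj_iff_of_isAfter hv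
  by_contra hnadj
  exact hclaw (h.adj_sub i) ((hu' i).2 (by simp)).symm ((hv' i).2 (by simp)).symm
    (h.ne_of_isAfter hu _).symm (h.ne_of_isAfter hv _).symm huv
    (by rw [G.adj_comm, hu']; grind) (by rw [G.adj_comm, hv']; grind) hnadj

theorem ne_of_isAt_of_isAfter (h : G.IsMinHole e f) {u v : V} {i j : ZMod k}
    (hu : G.IsAt e f u i) (hv : G.IsAfter e f v j) : u ≠ v := by
  rintro rfl
  obtain ⟨h1, h2, h3, h4⟩ := h.ne_zero
  have h₁ := (hu i).symm.trans (hv i)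
  have h₂ := (hu (i - e)).symm.trans (hv (i - e))
  have h₃ := (hu (i + e)).symm.trans (hv (i + e))
  grind

theorem adj_of_isAt_of_isAfter (h : G.IsMinHole e f) (hclaw : G.ClawFree) {u v : V}
    {i : ZMod k} (hu : G.IsAt e f u i) (hv : G.IsAfter e f v i) : G.Adj u v := by
  obtain ⟨h1, h2, h3, h4⟩ := h.ne_zero
  have hv' := h.adj_iff_of_isAfter hv
  by_cases hui : u = f i
  · rw [hui, G.adj_comm, hv']
    simp
  by_contra hnadj
  exact hclaw ((h.adj_iff (i + e) (i + 2 * e)).2 (by grind))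
    ((h.adj_iff_of_isAt hu (j := i + e) (by grind)).2 (by simp)).symm
    ((hv' (i + e)).2 (by simp)).symm
    (h.ne_of_isAt hu (by grind)).symm (h.ne_of_isAfter hv _).symm (h.ne_of_isAt_of_isAfter hu hv)
    (by rw [G.adj_comm, h.adj_iff_of_isAt hu (by grind)]; grind)
    (by rw [G.adj_comm, hv']; grind) hnadj

theorem rev (h : G.IsMinHole e f) : G.IsMinHole e fun i => f (-i) where
  eq_one := h.eq_one
  isHoleOn := by
    refine ⟨h.isHoleOn.1, h.injective.comp neg_injective, fun i j => ?_⟩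
    rw [h.adj_iff, h.eq_one]
    grind
  le := h.le
  five_le := h.five_le

theorem _root_.SimpleGraph.IsAt.rev {v : V} {i : ZMod k} (hv : G.IsAt e f v i) :
    G.IsAt e (fun i => f (-i)) v (-i) := by
  intro j
  refine (hv (-j)).trans ?_
  grind

theorem _root_.SimpleGraph.IsAfter.rev {v : V} {i : ZMod k} (hv : G.IsAfter e f v i) :
    G.IsAfter e (fun i => f (-i)) v (-i - e) := by
  intro j
  refine (hv (-j)).trans ?_
  grind

theorem adj_of_isAfter_of_isAt (h : G.IsMinHole e f) (hclaw : G.ClawFree) {u v : V}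
    {i : ZMod k} (hu : G.IsAfter e f u i) (hv : G.IsAt e f v (i + e)) : G.Adj u v := by
  refine (h.rev.adj_of_isAt_of_isAfter hclaw hv.rev ?_).symm
  convert hu.rev using 1
  ring

theorem update (h : G.IsMinHole e f) {u : V} {i : ZMod k} (hu : G.IsAt e f u i) :
    G.IsMinHole e (Function.update f i u) where
  eq_one := h.eq_one
  isHoleOn := by
    refine ⟨h.isHoleOn.1, fun x y hxy => ?_, fun x y => ?_⟩
    · by_cases hx : x = i <;> by_cases hy : y = i
      · exact hx.trans hy.symm
      · subst hx
        rw [Function.update_self, Function.update_of_ne hy] at hxy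
        exact absurd hxy (h.ne_of_isAt hu hy)
      · subst hy
        rw [Function.update_self, Function.update_of_ne hx] at hxy
        exact absurd hxy.symm (h.ne_of_isAt hu hx)
      · rw [Function.update_of_ne hx, Function.update_of_ne hy] at hxy
        exact h.injective hxy
    · rw [← h.eq_one]
      obtain ⟨h1, -⟩ := h.ne_zero
      by_cases hx : x = i <;> by_cases hy : y = i
      · rw [hx, hy]
        exact iff_of_false G.irrefl (by grind)
      · subst hx
        rw [Function.update_self, Function.update_of_ne hy, h.adj_iff_of_isAt hu hy]
        grind
      · subst hy
        rw [Function.update_self, Function.update_of_ne hx, G.adj_comm, h.adj_iff_of_isAt hu hx]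
        grind
      · rw [Function.update_of_ne hx, Function.update_of_ne hy, h.adj_iff]
  le := h.le
  five_le := h.five_le

theorem sees_update {v u : V} {i j : ZMod k} (hj : j ≠ i) :
    G.Sees (Function.update f i u) v j ↔ G.Sees f v j := by
  rw [Sees, Sees, Function.update_of_ne hj]

theorem sees_of_adj_of_isAt (h : G.IsMinHole e f) (hclaw : G.ClawFree) {u v : V} {i : ZMod k}
    (hu : G.IsAt e f u i) (huv : G.Adj u v) : G.Sees f v (i - e) ∨ G.Sees f v (i + e) := by
  obtain ⟨h1, -⟩ := h.ne_zero
  have hi : G.Sees (Function.update f i u) v i := by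
    rw [Sees, Function.update_self]
    exact Or.inr huv.symm
  have := (h.update hu).sees_pred_or_succ hclaw hi
  rwa [sees_update (by grind), sees_update (by grind)] at this

theorem eq_of_adj_of_isAt_of_isAfter (h : G.IsMinHole e f) (hclaw : G.ClawFree) {u v : V}
    {i j : ZMod k} (hu : G.IsAt e f u i) (hv : G.IsAfter e f v j) (huv : G.Adj u v) :
    i = j - e ∨ i = j ∨ i = j + e ∨ i = j + 2 * e := by
  have := h.sees_of_adj_of_isAt hclaw hu huv
  rw [hv, hv] at this
  grind

theorem ne_add_of_adj_of_isAt_of_isAt (h : G.IsMinHole e f) (hclaw : G.ClawFree)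
    (hsq : G.SquareFree) (hwheel : G.WheelFree) {u v : V} {i : ZMod k} (hu : G.IsAt e f u i)
    (hv : G.IsAt e f v (i + 2 * e)) : ¬ G.Adj u v := by
  intro huv
  obtain ⟨h1, h2, h3, h4⟩ := h.ne_zero
  have hi : G.Sees (Function.update f i u) v i := by
    rw [Sees, Function.update_self]
    exact Or.inr huv.symm
  refine (h.update hu).not_sees_four hclaw hsq hwheel hi ?_ ?_ ?_ <;>
  · rw [sees_update (by grind), hv]
    grind

theorem eq_of_adj_of_isAt_of_isAt (h : G.IsMinHole e f) (hclaw : G.ClawFree)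
    (hsq : G.SquareFree) (hwheel : G.WheelFree) {u v : V} {i j : ZMod k} (hu : G.IsAt e f u i)
    (hv : G.IsAt e f v j) (huv : G.Adj u v) : i = j - e ∨ i = j ∨ i = j + e := by
  have h₁ := h.sees_of_adj_of_isAt hclaw hu huv
  rw [hv, hv] at h₁
  have h₂ : j ≠ i + 2 * e := by
    rintro rfl
    exact h.ne_add_of_adj_of_isAt_of_isAt hclaw hsq hwheel hu hv huv
  have h₃ : i ≠ j + 2 * e := by
    rintro rfl
    exact h.ne_add_of_adj_of_isAt_of_isAt hclaw hsq hwheel hv hu huv.symm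
  grind

theorem ne_add_of_adj_of_isAfter_of_isAfter (h : G.IsMinHole e f) (hsq : G.SquareFree) {u v : V}
    {i : ZMod k} (hu : G.IsAfter e f u i) (hv : G.IsAfter e f v (i + 2 * e)) : ¬ G.Adj u v := by
  intro huv
  obtain ⟨h1, h2, h3, h4⟩ := h.ne_zero
  have hu' := h.adj_iff_of_isAfter hu
  have hv' := h.adj_iff_of_isAfter hv
  exact hsq ((hu' (i + e)).2 (by simp)) ((h.adj_iff (i + e) (i + 2 * e)).2 (by grind))
    ((hv' (i + 2 * e)).2 (by simp)).symm huv (h.ne_of_isAfter hu _)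
    (h.ne_of_isAfter hv _).symm (by rw [hu']; grind) (by rw [G.adj_comm, hv']; grind)

theorem eq_of_adj_of_isAfter_of_isAfter (h : G.IsMinHole e f) (hsq : G.SquareFree)
    (hnet : G.NetFree) {u v : V} {i j : ZMod k} (hu : G.IsAfter e f u i)
    (hv : G.IsAfter e f v j) (huv : G.Adj u v) : i = j - e ∨ i = j ∨ i = j + e := by
  obtain ⟨h1, h2, h3, h4⟩ := h.ne_zero
  have h₂ : j ≠ i + 2 * e := by
    rintro rfl
    exact h.ne_add_of_adj_of_isAfter_of_isAfter hsq hu hv huv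
  have h₃ : i ≠ j + 2 * e := by
    rintro rfl
    exact h.ne_add_of_adj_of_isAfter_of_isAfter hsq hv hu huv.symm
  have hu' := h.adj_iff_of_isAfter hu
  have hv' := h.adj_iff_of_isAfter hv
  by_contra! hne
  exact hnet ((hu' i).2 (by simp)) ((hu' (i + e)).2 (by simp)) (h.adj_add i) huv (h.adj_sub i)
    ((h.adj_iff (i + e) (i + 2 * e)).2 (by grind)) (by rw [hu']; grind) (by rw [hu']; grind)
    (by rw [G.adj_comm, hv']; grind) (by rw [h.adj_iff]; grind) (by rw [G.adj_comm, hv']; grind)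
    (by rw [h.adj_iff]; grind) (by rw [hv']; grind) (by rw [hv']; grind)
    (by rw [h.adj_iff]; grind)

theorem adj_of_isAt_of_adj (h : G.IsMinHole e f) (hclaw : G.ClawFree) {v a b : V} {i : ZMod k}
    (hv : G.IsAt e f v i) (ha : G.IsAfter e f a i) (hb : G.IsAfter e f b (i + e))
    (hvb : G.Adj v b) : G.Adj a b := by
  obtain ⟨h1, h2, h3, h4⟩ := h.ne_zero
  have ha' := h.adj_iff_of_isAfter ha
  have hb' := h.adj_iff_of_isAfter hb
  by_contra hnadj
  exact hclaw ((h.adj_iff_of_isAt hv (j := i - e) (by grind)).2 (by simp))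
    (h.adj_of_isAt_of_isAfter hclaw hv ha) hvb (h.ne_of_isAfter ha _).symm
    (h.ne_of_isAfter hb _).symm (by
      rintro rfl
      have := (ha i).symm.trans (hb i)
      grind)
    (by rw [G.adj_comm, ha']; grind) (by rw [G.adj_comm, hb']; grind) hnadj

theorem adj_of_isAfter_of_adj (h : G.IsMinHole e f) (hclaw : G.ClawFree) (hsq : G.SquareFree)
    {v a b : V} {i : ZMod k} (hv : G.IsAfter e f v i) (ha : G.IsAt e f a (i + e))
    (hb : G.IsAt e f b (i + 2 * e)) (hvb : G.Adj v b) : G.Adj a b := by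
  obtain ⟨h1, h2, h3, h4⟩ := h.ne_zero
  have hv' := h.adj_iff_of_isAfter hv
  have ha2 : G.Adj a (f (i + 2 * e)) := by
    rw [h.adj_iff_of_isAt ha (by grind)]
    grind
  by_cases hb2 : b = f (i + 2 * e)
  · rwa [hb2]
  by_contra hnadj
  exact hsq (h.adj_of_isAfter_of_isAt hclaw hv ha) ha2
    (((hb (i + 2 * e)).2 (by simp)).resolve_left hb2).symm hvb (h.ne_of_isAfter hv _) (by
      rintro rfl
      have := (ha i).symm.trans (hb i)
      grind) (by rw [hv']; grind) hnadj

end IsMinHole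

end SimpleGraph

namespace SimpleGraph

variable {V : Type*} {G : SimpleGraph V} {k : ℕ} {e : ZMod k} {f : ZMod k → V}

theorem isOffset_iterate {α : Type*} {s : α → α} (hs : s.Injective)
    (h : ∀ p m, s^[m] p = p → m < 10 → m = 0) (pos : V → α) :
    IsOffset fun u v d => pos v = s^[d] (pos u) where
  refl _ := rfl
  eq_zero _ _ h₁ h₂ := h _ _ h₁.symm h₂
  trans _ _ _ i j h₁ h₂ := by rw [h₂, h₁, ← Function.iterate_add_apply, add_comm]
  left _ _ _ i j h₁ h₂ hij := by
    rw [h₁, h₂, ← Function.iterate_add_apply, Nat.sub_add_cancel hij]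
  right _ _ _ i j h₁ h₂ hij := by
    apply hs.iterate i
    rw [← h₁, h₂, ← Function.iterate_add_apply, Nat.add_sub_cancel' hij]

/-- The successor in the cyclic order of the positions on a hole with generator `e`, where
`(i, false)` is the vertex `i` and `(i, true)` lies between `i` and `i + e`. -/
def holeStep (e : ZMod k) : ZMod k × Bool → ZMod k × Bool
  | (i, false) => (i, true)
  | (i, true) => (i + e, false)

theorem holeStep_injective (e : ZMod k) : (holeStep e).Injective := by
  rintro ⟨i, _ | _⟩ ⟨j, _ | _⟩ <;> simp [holeStep]

namespace IsMinHole

theorem exists_isCoarseLayout (h : G.IsMinHole e f) (hconn : G.Connected) (hclaw : G.ClawFree)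
    (hsq : G.SquareFree) (hnet : G.NetFree) (hwheel : G.WheelFree) : ∃ Q, G.IsCoarseLayout Q := by
  obtain ⟨h1, h2, h3, h4⟩ := h.ne_zero
  have hex : ∀ v, ∃ p : ZMod k × Bool,
      (p.2 = false → G.IsAt e f v p.1) ∧ (p.2 = true → G.IsAfter e f v p.1) := by
    intro v
    obtain ⟨i, hi | hi⟩ := h.exists_isAt_or_isAfter hconn hclaw hsq hnet hwheel v
    exacts [⟨(i, false), by simpa using hi⟩, ⟨(i, true), by simpa using hi⟩]
  choose pos hat haft using hex
  have hatEq : ∀ {v i}, pos v = (i, false) → G.IsAt e f v i := fun {v i} hv => by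
    simpa [hv] using hat v
  have haftEq : ∀ {v i}, pos v = (i, true) → G.IsAfter e f v i := fun {v i} hv => by
    simpa [hv] using haft v
  have hcases : ∀ v, ∃ i, (pos v = (i, false) ∧ G.IsAt e f v i) ∨
      (pos v = (i, true) ∧ G.IsAfter e f v i) := by
    intro v
    rcases hp : pos v with ⟨i, _ | _⟩
    exacts [⟨i, Or.inl ⟨rfl, hatEq hp⟩⟩, ⟨i, Or.inr ⟨rfl, haftEq hp⟩⟩]
  refine ⟨fun u v d => pos v = (holeStep e)^[d] (pos u),
    isOffset_iterate (holeStep_injective e) ?_ pos, ?_, ?_, ?_, ?_⟩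
  · rintro ⟨i, _ | _⟩ m hm hlt <;> interval_cases m <;> simp [holeStep] at hm ⊢ <;> grind
  · intro u v d huv hd hne
    obtain ⟨i, ⟨hu, hu'⟩ | ⟨hu, hu'⟩⟩ := hcases u <;> rw [hu] at huv <;> interval_cases d
    · exact h.adj_of_isAt_of_isAt hsq hu' (hatEq huv) hne
    · exact h.adj_of_isAt_of_isAfter hclaw hu' (haftEq huv)
    · exact h.adj_of_isAfter_of_isAfter hclaw hu' (haftEq huv) hne
    · exact h.adj_of_isAfter_of_isAt hclaw hu' (hatEq huv)
  · have hmixed : ∀ {u v i j}, pos u = (i, false) → pos v = (j, true) → G.Adj u v →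
        ∃ d, d ≤ 3 ∧ (pos v = (holeStep e)^[d] (pos u) ∨ pos u = (holeStep e)^[d] (pos v)) := by
      intro u v i j hu hv huv
      rw [hu, hv]
      rcases h.eq_of_adj_of_isAt_of_isAfter hclaw (hatEq hu) (haftEq hv) huv with
        rfl | rfl | rfl | rfl
      · exact ⟨3, by simp [holeStep]⟩
      · exact ⟨1, by simp [holeStep]⟩
      · exact ⟨1, by simp [holeStep]⟩
      · exact ⟨3, by simp [holeStep]; grind⟩
    intro u v huv
    obtain ⟨i, ⟨hu, hu'⟩ | ⟨hu, hu'⟩⟩ := hcases u <;>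
      obtain ⟨j, ⟨hv, hv'⟩ | ⟨hv, hv'⟩⟩ := hcases v
    · rw [hu, hv]
      rcases h.eq_of_adj_of_isAt_of_isAt hclaw hsq hwheel hu' hv' huv with rfl | rfl | rfl
      exacts [⟨2, by simp [holeStep]⟩, ⟨0, by simp⟩, ⟨2, by simp [holeStep]⟩]
    · exact hmixed hu hv huv
    · simpa only [or_comm] using hmixed hv hu huv.symm
    · rw [hu, hv]
      rcases h.eq_of_adj_of_isAfter_of_isAfter hsq hnet hu' hv' huv with rfl | rfl | rfl
      exacts [⟨2, by simp [holeStep]⟩, ⟨0, by simp⟩, ⟨2, by simp [holeStep]⟩]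
  · intro v a b ha hb hvb
    obtain ⟨i, ⟨hv, hv'⟩ | ⟨hv, hv'⟩⟩ := hcases v <;> rw [hv] at ha hb
    · exact h.adj_of_isAt_of_adj hclaw hv' (haftEq ha) (haftEq hb) hvb
    · refine h.adj_of_isAfter_of_adj hclaw hsq hv' (hatEq ha) (hatEq ?_) hvb
      rw [hb]
      simp [holeStep]
      ring
  · intro v a b ha hb hvb
    obtain ⟨i, ⟨hv, hv'⟩ | ⟨hv, hv'⟩⟩ := hcases v <;> rw [hv] at ha hb
    · obtain ⟨j, ⟨ha', haj⟩ | ⟨ha', haj⟩⟩ := hcases a <;>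
        obtain ⟨l, ⟨hb', hbl⟩ | ⟨hb', hbl⟩⟩ := hcases b <;> rw [ha'] at ha <;> rw [hb'] at hb <;>
        simp [holeStep] at ha hb
      refine h.rev.adj_of_isAt_of_adj hclaw hv'.rev (a := a) (b := b) ?_ ?_ hvb
      · convert haj.rev using 1
        grind
      · convert hbl.rev using 1
        grind
    · obtain ⟨j, ⟨ha', haj⟩ | ⟨ha', haj⟩⟩ := hcases a <;>
        obtain ⟨l, ⟨hb', hbl⟩ | ⟨hb', hbl⟩⟩ := hcases b <;> rw [ha'] at ha <;> rw [hb'] at hb <;>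
        simp [holeStep] at ha hb
      refine h.rev.adj_of_isAfter_of_adj hclaw hsq hv'.rev (a := a) (b := b) ?_ ?_ hvb
      · convert haj.rev using 1
        grind
      · convert hbl.rev using 1
        grind

end IsMinHole

end SimpleGraph

/-- A connected {claw, tent S_3, net, C_4, W_5}-free graph is a proper
Helly circular-arc graph. -/
theorem stmt2 {V : Type*} [Fintype V] (G : SimpleGraph V) (hconn : G.Connected)
    (hclaw : ¬ G.HasInducedCopy clawGraph) (htent : ¬ G.HasInducedCopy tentGraph)
    (hnet : ¬ G.HasInducedCopy netGraph) (hc4 : ¬ G.HasInducedCopy (cycleG 4))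
    (hw5 : ¬ G.HasInducedCopy (wheelG 5)) :
    G.IsPHCA := by
  have hclaw' := SimpleGraph.clawFree_of_not_hasInducedCopy hclaw
  have hsq := SimpleGraph.squareFree_of_not_hasInducedCopy hc4
  have hnet' := SimpleGraph.netFree_of_not_hasInducedCopy hnet
  have hlayout : ∃ Q, G.IsCoarseLayout Q := by
    by_cases hchord : G.Chordal
    · exact hchord.exists_isCoarseLayout hconn hclaw' hsq hnet'
        (SimpleGraph.tentFree_of_not_hasInducedCopy htent)
    · obtain ⟨k, e, f, hf⟩ := SimpleGraph.exists_isMinHole hsq (not_not.1 hchord)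
      exact hf.exists_isCoarseLayout hconn hclaw' hsq hnet'
        (SimpleGraph.wheelFree_of_not_hasInducedCopy hw5)
  obtain ⟨Q, hQ⟩ := hlayout
  obtain ⟨D, hD⟩ := hQ.exists_isRoundOrientation hclaw' hsq
  exact hD.isPHCA hconn
end

section
/- If a proper Helly circular-arc graph is chordal, then it is a unit interval graph. -/
/-- An umbrella ordering of the vertices of a finite graph makes it a unit interval graph. -/
theorem SimpleGraph.isUnitIntervalGraph_of_umbrella {V : Type*} [Fintype V] (G : SimpleGraph V)
    (s : V → ℝ) (hs : Function.Injective s)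
    (h : ∀ u v w, s u < s v → s v < s w → G.Adj u w → G.Adj u v ∧ G.Adj v w) :
    G.IsUnitIntervalGraph := by
  classical
  have key : ∀ S : Finset V, ∃ f : V → ℝ, ∀ u ∈ S, ∀ v ∈ S, s u < s v →
      f u < f v ∧ (G.Adj u v → f v < f u + 1) ∧ (¬ G.Adj u v → f u + 1 < f v) := by
    intro S
    refine Finset.induction_on_max_value s S ⟨fun _ => 0, by simp⟩ ?_
    rintro a T haT hmax ⟨f, hf⟩
    have hlt : ∀ x ∈ T, s x < s a := fun x hx =>
      lt_of_le_of_ne (hmax x hx) fun e => haT (hs e ▸ hx)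
    obtain ⟨y, hy1, hy2⟩ := Order.exists_between_finsets
      (T.image f ∪ (T.filter fun x => ¬ G.Adj x a).image fun x => f x + 1)
      ((T.filter fun x => G.Adj x a).image fun x => f x + 1) (by
        intro l hl r hr
        simp only [Finset.mem_union, Finset.mem_image, Finset.mem_filter] at hl hr
        obtain ⟨z, ⟨hz, hza⟩, rfl⟩ := hr
        rcases hl with ⟨x, hx, rfl⟩ | ⟨x, ⟨hx, hxa⟩, rfl⟩
        · rcases lt_trichotomy (s x) (s z) with hxz | hxz | hxz
          · linarith [(hf x hx z hz hxz).1]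
          · rw [hs hxz]; linarith
          · exact (hf z hz x hx hxz).2.1 (h z x a hxz (hlt x hx) hza).1
        · rcases lt_trichotomy (s x) (s z) with hxz | hxz | hxz
          · linarith [(hf x hx z hz hxz).1]
          · exact absurd (hs hxz ▸ hza) hxa
          · exact absurd (h z x a hxz (hlt x hx) hza).2 hxa)
    have h1 : ∀ x ∈ T, f x < y := fun x hx =>
      hy1 _ (Finset.mem_union_left _ (Finset.mem_image_of_mem f hx))
    have h2 : ∀ x ∈ T, ¬ G.Adj x a → f x + 1 < y := fun x hx hxa =>
      hy1 _ (Finset.mem_union_right _ (Finset.mem_image.2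
        ⟨x, Finset.mem_filter.2 ⟨hx, hxa⟩, rfl⟩))
    have h3 : ∀ x ∈ T, G.Adj x a → y < f x + 1 := fun x hx hxa =>
      hy2 _ (Finset.mem_image.2 ⟨x, Finset.mem_filter.2 ⟨hx, hxa⟩, rfl⟩)
    refine ⟨Function.update f a y, fun u hu v hv huv => ?_⟩
    rcases Finset.mem_insert.1 hu with rfl | huT
    · rcases Finset.mem_insert.1 hv with rfl | hv
      · exact absurd huv (lt_irrefl _)
      · exact absurd huv (hlt v hv).not_gt
    · have hua : u ≠ a := fun e => haT (e ▸ huT)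
      rcases Finset.mem_insert.1 hv with rfl | hv
      · simpa [hua] using ⟨h1 u huT, h3 u huT, h2 u huT⟩
      · have hva : v ≠ a := fun e => haT (e ▸ hv)
        simpa [hua, hva] using hf u huT v hv huv
  obtain ⟨f, hf⟩ := key Finset.univ
  have main : ∀ u v, s u < s v → (G.Adj u v ↔ |f u - f v| ≤ 1) := by
    intro u v huv
    obtain ⟨h1, h2, h3⟩ := hf u (Finset.mem_univ _) v (Finset.mem_univ _) huv
    rw [abs_sub_comm, abs_of_pos (sub_pos.2 h1)]
    constructor
    · intro e; linarith [h2 e]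
    · intro e; by_contra hn; linarith [h3 hn]
  refine ⟨f, fun u v huv => ?_⟩
  rcases lt_or_gt_of_ne (hs.ne huv) with e | e
  · exact main u v e
  · rw [G.adj_comm, abs_sub_comm]; exact main v u e

/-- A chordal graph whose vertices are covered by two cliques is a unit interval graph. -/
theorem SimpleGraph.Chordal.isUnitIntervalGraph_of_cobipartite {V : Type*} [Fintype V]
    {G : SimpleGraph V} (hG : G.Chordal) (P : Set V)
    (hP : ∀ u ∈ P, ∀ v ∈ P, u ≠ v → G.Adj u v)
    (hQ : ∀ u ∉ P, ∀ v ∉ P, u ≠ v → G.Adj u v) : G.IsUnitIntervalGraph := by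
  have nested : ∀ p ∈ P, ∀ p' ∈ P, ∀ q ∉ P, ∀ q' ∉ P, G.Adj p q → G.Adj p' q' →
      ¬ G.Adj p q' → G.Adj p' q := by
    intro p hp p' hp' q hq q' hq' h1 h2 h3
    by_contra h4
    have hpp : p ≠ p' := by rintro rfl; exact h4 h1
    have hqq : q ≠ q' := by rintro rfl; exact h4 h2
    have a1 := hP p hp p' hp' hpp
    have a2 := hQ q hq q' hq' hqq
    refine hG ⟨4, ![p, q, q', p'], le_rfl, ?_, ?_⟩
    · have n1 := h1.ne
      have n2 := h2.ne
      have n3 : p ≠ q' := fun e => hq' (e ▸ hp)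
      have n4 : p' ≠ q := fun e => hq (e ▸ hp')
      intro i j hij
      change Fin 4 at i j
      fin_cases i <;> fin_cases j <;> first | rfl | simp_all
    · have b1 := h1.symm
      have b2 := h2.symm
      have b3 := a1.symm
      have b4 := a2.symm
      have c3 : ¬ G.Adj q' p := fun e => h3 e.symm
      have c4 : ¬ G.Adj q p' := fun e => h4 e.symm
      have hcycle : ∀ i j : Fin 4, G.Adj (![p, q, q', p'] i) (![p, q, q', p'] j) ↔
          (i = j + 1 ∨ j = i + 1) := by
        intro i j
        fin_cases i <;> fin_cases j <;> simp [*]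
      exact hcycle
  classical
  let N : V → Finset V := fun p => Finset.univ.filter fun q => q ∉ P ∧ G.Adj p q
  let n : ℝ := Fintype.card V + 1
  have hn : 0 < n := by positivity
  have hcard : ∀ p, ((N p).card : ℝ) < n := fun p => by
    have : ((N p).card : ℝ) ≤ Fintype.card V := by exact_mod_cast Finset.card_le_univ _
    simp only [n]; linarith
  have hsub : ∀ p ∈ P, ∀ p' ∈ P, ∀ q ∉ P, G.Adj p' q → (N p').card ≤ (N p).card →
      G.Adj p q := by
    intro p hp p' hp' q hq hadj hle
    by_contra hno
    have hss : N p ⊂ N p' := by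
      refine Finset.ssubset_iff_subset_ne.2 ⟨?_, ?_⟩
      · intro q' hq'
        simp only [N, Finset.mem_filter, Finset.mem_univ, true_and] at hq' ⊢
        exact ⟨hq'.1, nested p hp p' hp' q' hq'.1 q hq hq'.2 hadj hno⟩
      · intro e
        have : q ∈ N p' := by simp [N, hq, hadj]
        rw [← e] at this
        simp [N, hno] at this
    exact absurd (Finset.card_lt_card hss) (not_lt.2 hle)
  have hr : ∀ q, q ∉ P → ∃ r : ℝ, 0 ≤ r ∧ r ≤ n ∧
      ∀ p ∈ P, (G.Adj p q ↔ r ≤ (N p).card) := by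
    intro q hq
    by_cases hne : (Finset.univ.filter fun p => p ∈ P ∧ G.Adj p q).Nonempty
    · obtain ⟨p₀, hp₀, hmin⟩ := Finset.exists_min_image _ (fun p => (N p).card) hne
      simp only [Finset.mem_filter, Finset.mem_univ, true_and] at hp₀ hmin
      refine ⟨(N p₀).card, by positivity, (hcard p₀).le, fun p hp => ⟨fun e => ?_, fun e => ?_⟩⟩
      · exact_mod_cast hmin p ⟨hp, e⟩
      · exact hsub p hp p₀ hp₀.1 q hq hp₀.2 (by exact_mod_cast e)
    · refine ⟨n, hn.le, le_rfl, fun p hp => ⟨fun e => ?_, fun e => ?_⟩⟩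
      · exact absurd ⟨p, by simp [hp, e]⟩ hne
      · exact absurd e (not_le.2 (hcard p))
  choose! r hr0 hrn hradj using hr
  have mixed : ∀ p ∈ P, ∀ q ∉ P,
      (G.Adj p q ↔ |((N p).card : ℝ) / n - (1 + r q / n)| ≤ 1) := by
    intro p hp q hq
    have h1 : ((N p).card : ℝ) / n < 1 := (div_lt_one hn).2 (hcard p)
    have h2 : 0 ≤ r q / n := div_nonneg (hr0 q hq) hn.le
    rw [hradj q hq p hp, abs_sub_comm, abs_of_nonneg (by linarith),
      ← div_le_div_iff_of_pos_right hn]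
    constructor <;> intro <;> linarith
  refine ⟨fun v => if v ∈ P then ((N v).card : ℝ) / n else 1 + r v / n, fun u v huv => ?_⟩
  by_cases hu : u ∈ P <;> by_cases hv : v ∈ P <;> simp only [hu, hv, if_true, if_false]
  · refine iff_of_true (hP u hu v hv huv) (abs_le.2 ?_)
    have h1 : ((N u).card : ℝ) / n < 1 := (div_lt_one hn).2 (hcard u)
    have h2 : ((N v).card : ℝ) / n < 1 := (div_lt_one hn).2 (hcard v)
    have h3 : 0 ≤ ((N u).card : ℝ) / n := by positivity
    have h4 : 0 ≤ ((N v).card : ℝ) / n := by positivity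
    constructor <;> linarith
  · exact mixed u hu v hv
  · rw [G.adj_comm, abs_sub_comm]; exact mixed v hv u hu
  · refine iff_of_true (hQ u hu v hv huv) (abs_le.2 ?_)
    have h1 : r u / n ≤ 1 := (div_le_one hn).2 (hrn u hu)
    have h2 : r v / n ≤ 1 := (div_le_one hn).2 (hrn v hv)
    have h3 : 0 ≤ r u / n := div_nonneg (hr0 u hu) hn.le
    have h4 : 0 ≤ r v / n := div_nonneg (hr0 v hv) hn.le
    constructor <;> linarith

theorem AddCircle.coe_eq_coe_iff_exists {L x y : ℝ} :
    (x : AddCircle L) = y ↔ ∃ m : ℤ, x = y + m * L := by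
  rw [← sub_eq_zero, ← AddCircle.coe_sub, AddCircle.coe_eq_zero_iff]
  refine exists_congr fun m => ?_
  rw [zsmul_eq_mul]
  constructor <;> intro h <;> linarith

theorem AddCircle.coe_add_int_mul (L x : ℝ) (m : ℤ) :
    ((x + m * L : ℝ) : AddCircle L) = x :=
  AddCircle.coe_eq_coe_iff_exists.2 ⟨m, rfl⟩

/-- The points of a nonempty finite subset of a fundamental domain, continued periodically,
form a strictly increasing bi-infinite sequence. -/
theorem Finset.exists_periodic_enumeration (T : Finset ℝ) (hne : T.Nonempty) {L : ℝ}
    (hT : ∀ x ∈ T, 0 ≤ x ∧ x < L) :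
    ∃ p : ℤ → ℝ, StrictMono p ∧ (∀ i m : ℤ, p (i + T.card * m) = p i + m * L) ∧
      (∀ i, ∃ x ∈ T, ∃ m : ℤ, p i = x + m * L) ∧ ∀ x ∈ T, ∃ i, p i = x := by
  have hk : (0 : ℤ) < T.card := by exact_mod_cast hne.card_pos
  have hL : 0 < L := by
    obtain ⟨x, hx⟩ := hne
    linarith [hT x hx]
  have hlt : ∀ i : ℤ, (i % T.card).toNat < T.card := fun i => by
    have := Int.emod_lt_of_pos i hk
    omega
  let o := T.orderEmbOfFin rfl
  have hmem : ∀ i, o i ∈ T := T.orderEmbOfFin_mem rfl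
  refine ⟨fun i => o ⟨(i % T.card).toNat, hlt i⟩ + (i / T.card : ℤ) * L, ?_, ?_, ?_, ?_⟩
  · intro i j hij
    dsimp only
    have hdiv : i / T.card ≤ j / T.card := Int.ediv_le_ediv hk hij.le
    rcases hdiv.eq_or_lt with e | e
    · rw [e]
      have h1 := Int.emod_nonneg i hk.ne'
      have h2 := Int.mul_ediv_add_emod i T.card
      have h3 := Int.mul_ediv_add_emod j T.card
      rw [e] at h2
      have : o ⟨(i % T.card).toNat, hlt i⟩ < o ⟨(j % T.card).toNat, hlt j⟩ := by
        apply o.strictMono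
        rw [Fin.mk_lt_mk]
        omega
      linarith
    · have e' : ((i / T.card : ℤ) : ℝ) + 1 ≤ (j / T.card : ℤ) := by exact_mod_cast e
      have h1 := hT _ (hmem ⟨(i % T.card).toNat, hlt i⟩)
      have h2 := hT _ (hmem ⟨(j % T.card).toNat, hlt j⟩)
      nlinarith
  · intro i m
    simp only [Int.add_mul_emod_self_left, Int.add_mul_ediv_left _ _ hk.ne']
    push_cast
    ring
  · exact fun i => ⟨_, hmem _, _, rfl⟩
  · intro x hx
    have : x ∈ Set.range o := by simpa [o] using hx
    obtain ⟨⟨j, hj⟩, rfl⟩ := this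
    refine ⟨j, ?_⟩
    have h1 : ((j : ℤ) % T.card).toNat = j := by
      rw [Int.emod_eq_of_lt (by omega) (by omega)]; simp
    have h2 : (j : ℤ) / T.card = 0 := Int.ediv_eq_zero_of_lt (by omega) (by omega)
    simp [h1, h2]

theorem StrictMono.exists_int_mem_Ico {p : ℤ → ℝ} (hp : StrictMono p) {k : ℤ} {L : ℝ}
    (hL : 0 < L) (hper : ∀ i m : ℤ, p (i + k * m) = p i + m * L) (x : ℝ) :
    ∃ j : ℤ, p j ≤ x ∧ x < p (j + 1) := by
  obtain ⟨m, hm⟩ := exists_int_lt ((x - p 0) / L)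
  obtain ⟨M, hM⟩ := exists_int_gt ((x - p 0) / L)
  rw [lt_div_iff₀ hL] at hm
  rw [div_lt_iff₀ hL] at hM
  obtain ⟨j, hj, hmax⟩ := Int.exists_greatest_of_bdd (P := fun j => p j ≤ x)
    ⟨0 + k * M, fun z hz => by
      refine (hp.lt_iff_lt.1 (?_ : p z < p (0 + k * M))).le
      rw [hper]; linarith⟩
    ⟨0 + k * m, by rw [hper]; linarith⟩
  refine ⟨j, hj, ?_⟩
  by_contra h
  have := hmax (j + 1) (not_lt.1 h)
  omega

namespace PreArcModel

theorem isConnected_arc {V : Type*} (A : PreArcModel V) (v : V) : IsConnected (A.arc v) :=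
  (isConnected_Icc (by linarith [A.len_pos v])).image _ (AddCircle.continuous_mk' _).continuousOn

theorem isClosed_arc {V : Type*} (A : PreArcModel V) (v : V) : IsClosed (A.arc v) :=
  haveI : Fact (0 < A.L) := ⟨A.L_pos⟩
  (isCompact_Icc.image (AddCircle.continuous_mk' _)).isClosed

theorem ccp_mem_arc {V : Type*} (A : PreArcModel V) (v : V) : A.ccp v ∈ A.arc v :=
  ⟨_, ⟨le_rfl, by linarith [A.len_pos v]⟩, rfl⟩

theorem cp_mem_arc {V : Type*} (A : PreArcModel V) (v : V) : A.cp v ∈ A.arc v :=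
  ⟨_, ⟨by linarith [A.len_pos v], le_rfl⟩, rfl⟩

/-- An arc meeting both `A.arc u` and its complement contains an endpoint of `A.arc u`. -/
theorem endpoint_mem_arc {V : Type*} (A : PreArcModel V) {u w : V}
    (h1 : (A.arc w ∩ A.arc u).Nonempty) (h2 : ¬ A.arc w ⊆ A.arc u) :
    A.ccp u ∈ A.arc w ∨ A.cp u ∈ A.arc w := by
  by_contra! hno
  let I : Set (AddCircle A.L) :=
    (fun x : ℝ => (x : AddCircle A.L)) '' Set.Ioo (A.src u) (A.src u + A.len u)
  have hI : IsOpen I := QuotientAddGroup.isOpenMap_coe _ isOpen_Ioo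
  have hIu : I ⊆ A.arc u := Set.image_mono Set.Ioo_subset_Icc_self
  have huI : ∀ x ∈ A.arc w, x ∈ A.arc u → x ∈ I := by
    rintro _ hx ⟨y, ⟨hy1, hy2⟩, rfl⟩
    refine ⟨y, ⟨lt_of_le_of_ne hy1 ?_, lt_of_le_of_ne hy2 ?_⟩, rfl⟩
    · rintro rfl; exact hno.1 hx
    · rintro rfl; exact hno.2 hx
  rcases isPreconnected_iff_subset_of_disjoint.1 (A.isConnected_arc w).isPreconnected I
    (A.arc u)ᶜ hI (A.isClosed_arc u).isOpen_compl
    (fun x hx => (em (x ∈ A.arc u)).imp (huI x hx) id)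
    (by ext x; simpa using fun _ hx => hIu hx) with h | h
  · exact h2 (h.trans hIu)
  · obtain ⟨x, hx, hxu⟩ := h1
    exact h hx hxu

/-- A chordal graph with a proper arc model in which two arcs cover the circle is a unit interval
graph: each arc contains an endpoint of the first arc, so two cliques cover the vertices. -/
theorem isUnitIntervalGraph_of_two_cover {V : Type*} [Fintype V] {G : SimpleGraph V}
    (A : PreArcModel V) (hA : A.IsModelOf G) (hprop : A.Proper) (hG : G.Chordal) {u v : V}
    (huv : A.arc u ∪ A.arc v = Set.univ) : G.IsUnitIntervalGraph := by
  have hends : ∀ w, A.ccp u ∈ A.arc w ∨ A.cp u ∈ A.arc w := by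
    intro w
    have heq : ∀ x, A.arc w ⊆ A.arc x → A.arc w = A.arc x := fun x h => by
      by_contra hne
      exact hprop w x (ssubset_of_subset_of_ne h hne)
    by_cases h2 : A.arc w ⊆ A.arc u
    · rw [heq u h2]; exact Or.inl (A.ccp_mem_arc u)
    · refine A.endpoint_mem_arc ?_ h2
      by_contra h1
      have hd : ∀ x ∈ A.arc w, x ∉ A.arc u := fun x hx hxu => h1 ⟨x, hx, hxu⟩
      have hwv : A.arc w ⊆ A.arc v := fun x hx =>
        ((huv ▸ Set.mem_univ x : x ∈ A.arc u ∪ A.arc v)).resolve_left (hd x hx)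
      have hwv' := heq v hwv
      obtain ⟨x, -, hx1, hx2⟩ := isPreconnected_closed_iff.1
        (isPreconnected_univ (α := AddCircle A.L)) (A.arc u) (A.arc v)
        (A.isClosed_arc u) (A.isClosed_arc v) huv.ge
        (by simpa using (A.isConnected_arc u).nonempty)
        (by simpa using (A.isConnected_arc v).nonempty)
      exact hd x (hwv' ▸ hx2) hx1
  refine hG.isUnitIntervalGraph_of_cobipartite {w | A.ccp u ∈ A.arc w}
    (fun x hx y hy hxy => (hA.2 x y hxy).2 ⟨_, hx, hy⟩)
    (fun x hx y hy hxy => (hA.2 x y hxy).2 ⟨_, (hends x).resolve_left hx,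
      (hends y).resolve_left hy⟩)

/-- If a proper arc model does not cover the circle, then it cuts open to a proper
interval model. -/
theorem isUnitIntervalGraph_of_not_cover {V : Type*} [Fintype V] {G : SimpleGraph V}
    (A : PreArcModel V) (hA : A.IsModelOf G) (hprop : A.Proper) {α : AddCircle A.L}
    (hα : ∀ v, α ∉ A.arc v) : G.IsUnitIntervalGraph := by
  obtain ⟨x₀, rfl⟩ := QuotientAddGroup.mk_surjective α
  have hL := A.L_pos
  have hlift : ∀ v, ∃ a : ℝ, (a : AddCircle A.L) = A.ccp v ∧ x₀ < a ∧ a + A.len v < x₀ + A.L ∧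
      A.arc v = (fun x : ℝ => (x : AddCircle A.L)) '' Set.Icc a (a + A.len v) := by
    intro v
    have hmem := toIocMod_mem_Ioc A.L_pos x₀ (A.src v)
    have hsum := toIocMod_add_toIocDiv_zsmul A.L_pos x₀ (A.src v)
    set a := toIocMod A.L_pos x₀ (A.src v)
    set m := toIocDiv A.L_pos x₀ (A.src v)
    rw [zsmul_eq_mul] at hsum
    have harc : A.arc v = (fun x : ℝ => (x : AddCircle A.L)) '' Set.Icc a (a + A.len v) := by
      unfold arc
      rw [← hsum]
      ext z
      constructor
      · rintro ⟨y, ⟨hy1, hy2⟩, rfl⟩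
        refine ⟨y + (-m : ℤ) * A.L, ⟨?_, ?_⟩, AddCircle.coe_add_int_mul _ _ _⟩ <;>
          push_cast <;> linarith
      · rintro ⟨y, ⟨hy1, hy2⟩, rfl⟩
        exact ⟨y + m * A.L, ⟨by linarith, by linarith⟩, AddCircle.coe_add_int_mul _ _ _⟩
    refine ⟨a, ?_, hmem.1, ?_, harc⟩
    · rw [ccp, ← hsum, AddCircle.coe_add_int_mul]
    · by_contra hge
      refine hα v (harc ▸ ⟨x₀ + A.L, ⟨hmem.2, not_lt.1 hge⟩, ?_⟩)
      exact AddCircle.coe_add_period _ _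
  choose a ha hlo hhi harc using hlift
  have hlen := A.len_pos
  have hmem : ∀ v x, x₀ < x → x < x₀ + A.L →
      ((x : AddCircle A.L) ∈ A.arc v ↔ a v ≤ x ∧ x ≤ a v + A.len v) := by
    intro v x hx1 hx2
    rw [harc]
    constructor
    · rintro ⟨y, ⟨hy1, hy2⟩, hyx⟩
      have : Fact (0 < A.L) := ⟨A.L_pos⟩
      have e : y = x := (AddCircle.coe_eq_coe_iff_of_mem_Ico (a := x₀)
        ⟨by linarith [hlo v], by linarith [hhi v]⟩ ⟨hx1.le, hx2⟩).1 hyx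
      exact e ▸ ⟨hy1, hy2⟩
    · exact fun h => ⟨x, h, rfl⟩
  have hinj : Function.Injective a := by
    intro u v huv
    have h : A.ccp u = A.ccp v := by rw [← ha, ← ha, huv]
    have := @hA.1 (u, false) (v, false) (by simpa using h)
    simpa using this
  have hmono : ∀ u v, a u < a v → a u + A.len u < a v + A.len v := by
    intro u v huv
    by_contra hge
    refine hprop v u ⟨?_, fun hsub => ?_⟩
    · rw [harc u, harc v]
      exact Set.image_mono (Set.Icc_subset_Icc huv.le (not_lt.1 hge))
    · have h1 := (hmem u (a u) (hlo u) (by linarith [hhi u, hlen u])).2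
        ⟨le_rfl, by linarith [hlen u]⟩
      have h2 := (hmem v (a u) (hlo u) (by linarith [hhi u, hlen u])).1 (hsub h1)
      linarith [h2.1]
  have hadj : ∀ u v, a u < a v → (G.Adj u v ↔ a v ≤ a u + A.len u) := by
    intro u v huv
    rw [hA.2 u v (fun e => huv.ne (congrArg a e))]
    constructor
    · rintro ⟨x, hxu, hxv⟩
      rw [harc u] at hxu
      obtain ⟨y, ⟨hy1, hy2⟩, rfl⟩ := hxu
      have := (hmem v y (by linarith [hlo u]) (by linarith [hhi u])).1 hxv
      linarith [this.1]
    · intro h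
      have hhv : a v < x₀ + A.L := by linarith [hhi v, hlen v]
      exact ⟨(a v : AddCircle A.L), (hmem u _ (hlo v) hhv).2 ⟨huv.le, h⟩,
        (hmem v _ (hlo v) hhv).2 ⟨le_rfl, by linarith [hlen v]⟩⟩
  refine G.isUnitIntervalGraph_of_umbrella a hinj fun u v w huv hvw huw => ?_
  rw [hadj u w (huv.trans hvw)] at huw
  rw [hadj u v huv, hadj v w hvw]
  exact ⟨by linarith, by linarith [hmono u v huv]⟩

theorem exists_segment_mem_arc {V : Type*} (A : PreArcModel V) {v : V} {x y : ℝ}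
    (hx : (x : AddCircle A.L) ∈ A.arc v) (hy : (y : AddCircle A.L) ∈ A.arc v) :
    ∃ m : ℤ, ∀ z ∈ Set.uIcc x (y + m * A.L), (z : AddCircle A.L) ∈ A.arc v := by
  obtain ⟨x', hx', hxx⟩ := hx
  obtain ⟨y', hy', hyy⟩ := hy
  obtain ⟨m, rfl⟩ := AddCircle.coe_eq_coe_iff_exists.1 hxx
  obtain ⟨m', rfl⟩ := AddCircle.coe_eq_coe_iff_exists.1 hyy
  refine ⟨m' - m, fun z hz => ⟨z + m * A.L, ?_, AddCircle.coe_add_int_mul _ _ _⟩⟩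
  rcases Set.mem_uIcc.1 hz with h | h <;> push_cast at h <;>
    constructor <;> linarith [hx'.1, hx'.2, hy'.1, hy'.2]

/-- The arcs of an inclusion-minimal cover of the circle, in cyclic order: each arc `f i`
contains exactly one of the representatives `p j` up to the period. -/
theorem exists_cyclic_cover {V : Type*} [Fintype V] (A : PreArcModel V)
    (hcov : ∀ α, ∃ v, α ∈ A.arc v) :
    ∃ (k : ℕ) (f : ZMod k → V) (p : ℤ → ℝ), 0 < k ∧ StrictMono p ∧
      (∀ i m : ℤ, p (i + k * m) = p i + m * A.L) ∧
      (∀ (i : ZMod k) (j : ℤ), (p j : AddCircle A.L) ∈ A.arc (f i) ↔ i = j) ∧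
      ∀ α, ∃ i, α ∈ A.arc (f i) := by
  classical
  have : Fact (0 < A.L) := ⟨A.L_pos⟩
  obtain ⟨S, hS, hmin⟩ := exists_minimal_of_wellFoundedLT
    (fun S : Finset V => ∀ α, ∃ v ∈ S, α ∈ A.arc v)
    ⟨Finset.univ, fun α => (hcov α).imp fun v hv => ⟨Finset.mem_univ _, hv⟩⟩
  have hpriv : ∀ v ∈ S, ∃ x : ℝ, (0 ≤ x ∧ x < A.L) ∧
      ∀ u ∈ S, ((x : AddCircle A.L) ∈ A.arc u ↔ u = v) := by
    intro v hv
    have h : ¬ ∀ α, ∃ u ∈ S.erase v, α ∈ A.arc u := fun h =>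
      Finset.notMem_erase v S (hmin h (Finset.erase_subset _ _) hv)
    push Not at h
    obtain ⟨α, hα⟩ := h
    have hmem : α ∈ (QuotientAddGroup.mk '' Set.Ico (0 : ℝ) (0 + A.L) : Set (AddCircle A.L)) := by
      rw [AddCircle.coe_image_Ico_eq]; trivial
    obtain ⟨x, hx, rfl⟩ := hmem
    rw [zero_add] at hx
    have honly : ∀ u ∈ S, (x : AddCircle A.L) ∈ A.arc u → u = v := fun u hu hxu => by
      by_contra hne
      exact hα u (Finset.mem_erase.2 ⟨hne, hu⟩) hxu
    obtain ⟨w, hw, hxw⟩ := hS (x : AddCircle A.L)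
    refine ⟨x, hx, fun u hu => ⟨honly u hu, ?_⟩⟩
    rintro rfl
    exact honly w hw hxw ▸ hxw
  choose! r hr hrarc using hpriv
  have hSne : S.Nonempty := by
    obtain ⟨v, hv, -⟩ := hS 0
    exact ⟨v, hv⟩
  have hrinj : Set.InjOn r S := fun u hu v hv huv =>
    (hrarc v hv u hu).1 (huv ▸ (hrarc u hu u hu).2 rfl)
  obtain ⟨p, hp, hper, hpT, hTp⟩ := (S.image r).exists_periodic_enumeration (hSne.image r)
    (L := A.L) (by simpa using hr)
  have hkpos := (hSne.image r).card_pos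
  set k := (S.image r).card
  have : NeZero k := ⟨hkpos.ne'⟩
  have hpv : ∀ i, ∃ v ∈ S, (p i : AddCircle A.L) = r v := by
    intro i
    obtain ⟨x, hx, m, hm⟩ := hpT i
    obtain ⟨v, hv, rfl⟩ := Finset.mem_image.1 hx
    exact ⟨v, hv, by rw [hm, AddCircle.coe_add_int_mul]⟩
  choose g hgS hg using hpv
  have hpp : ∀ i j : ℤ, (p i : AddCircle A.L) = p j ↔ (i : ZMod k) = j := by
    intro i j
    rw [AddCircle.coe_eq_coe_iff_exists, ZMod.intCast_eq_intCast_iff_dvd_sub]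
    constructor
    · rintro ⟨m, hm⟩
      rw [← hper] at hm
      exact ⟨-m, by rw [hp.injective hm]; ring⟩
    · rintro ⟨m, hm⟩
      refine ⟨-m, ?_⟩
      rw [← hper]
      congr 1
      linarith
  have hval : ∀ i : ZMod k, (((i.val : ℤ)) : ZMod k) = i := fun i => by simp
  have hgarc : ∀ i j : ℤ, (p j : AddCircle A.L) ∈ A.arc (g i) ↔ (i : ZMod k) = j := by
    intro i j
    rw [hg j, hrarc (g j) (hgS j) (g i) (hgS i), ← hpp i j, hg i, hg j]
    constructor
    · intro e; rw [e]
    · intro e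
      have := (hrarc (g i) (hgS i) (g i) (hgS i)).2 rfl
      rw [e] at this
      exact (hrarc (g j) (hgS j) (g i) (hgS i)).1 this
  refine ⟨k, fun i => g i.val, p, hkpos, hp, hper, fun i j => ?_, fun α => ?_⟩
  · rw [hgarc, hval]
  · obtain ⟨v, hv, hαv⟩ := hS α
    obtain ⟨j, hj⟩ := hTp (r v) (Finset.mem_image_of_mem r hv)
    refine ⟨j, ?_⟩
    have h1 : (p j : AddCircle A.L) ∈ A.arc (g ((j : ZMod k).val : ℤ)) := by
      rw [hgarc, hval]
    rw [hj, hrarc v hv _ (hgS _)] at h1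
    simpa only [h1] using hαv

end PreArcModel

/-- A chordal proper Helly circular-arc graph is a unit interval graph. -/
theorem stmt3 {V : Type*} [Fintype V] (G : SimpleGraph V) (hphca : G.IsPHCA)
    (hchordal : G.Chordal) :
    G.IsUnitIntervalGraph := by
  obtain ⟨A, hA, hprop, hhelly⟩ := hphca
  by_cases hcov : ∀ α, ∃ v, α ∈ A.arc v
  swap
  · push Not at hcov
    obtain ⟨α, hα⟩ := hcov
    exact A.isUnitIntervalGraph_of_not_cover hA hprop hα
  obtain ⟨k, f, p, hk, hp, hper, hpriv, hcover⟩ := A.exists_cyclic_cover hcov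
  have hfinj : Function.Injective f := by
    intro i j hij
    obtain ⟨i', rfl⟩ := ZMod.intCast_surjective i
    have h := (hpriv i' i').2 rfl
    rw [hij, hpriv] at h
    exact h.symm
  have hloc : ∀ (i : ZMod k) (j : ℤ) (x : ℝ), p j ≤ x → x ≤ p (j + 1) →
      (x : AddCircle A.L) ∈ A.arc (f i) → i = j ∨ i = j + 1 := by
    intro i j x hj1 hj2 hx
    obtain ⟨i', rfl⟩ := ZMod.intCast_surjective i
    obtain ⟨m, hm⟩ := A.exists_segment_mem_arc hx ((hpriv i' i').2 rfl)
    rw [← hper] at hm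
    rcases le_or_gt (i' + k * m) j with h | h
    · left
      exact (hpriv _ _).1 (hm (p j) (Set.mem_uIcc.2 (Or.inr ⟨hp.monotone h, hj1⟩)))
    · right
      have := (hpriv _ _).1 (hm (p (j + 1)) (Set.mem_uIcc.2 (Or.inl ⟨hj2, hp.monotone h⟩)))
      simpa using this
  have hlocα : ∀ α : AddCircle A.L, ∃ j : ZMod k, ∀ i, α ∈ A.arc (f i) → i = j ∨ i = j + 1 := by
    intro α
    obtain ⟨x, rfl⟩ := QuotientAddGroup.mk_surjective α
    obtain ⟨j, hj1, hj2⟩ := hp.exists_int_mem_Ico A.L_pos hper x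
    exact ⟨j, fun i hi => hloc i j x hj1 hj2.le hi⟩
  have hsucc : ∀ i : ZMod k, (A.arc (f i) ∩ A.arc (f (i + 1))).Nonempty := by
    intro i
    obtain ⟨j, rfl⟩ := ZMod.intCast_surjective i
    have hcont : Continuous fun x : ℝ => (x : AddCircle A.L) := AddCircle.continuous_mk' _
    have hle : p j ≤ p (j + 1) := hp.monotone (by omega)
    obtain ⟨x, -, hx1, hx2⟩ := isPreconnected_closed_iff.1
      (isPreconnected_Icc (a := p j) (b := p (j + 1)))
      _ _ ((A.isClosed_arc (f j)).preimage hcont) ((A.isClosed_arc (f (j + 1))).preimage hcont)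
      (fun x hx => by
        obtain ⟨i, hi⟩ := hcover (x : AddCircle A.L)
        rcases hloc i j x hx.1 hx.2 hi with rfl | rfl
        · exact Or.inl hi
        · exact Or.inr hi)
      ⟨p j, ⟨le_rfl, hle⟩, (hpriv _ _).2 rfl⟩
      ⟨p (j + 1), ⟨hle, le_rfl⟩, (hpriv _ _).2 (by push_cast; rfl)⟩
    exact ⟨_, hx1, hx2⟩
  rcases Nat.lt_or_ge k 3 with hk3 | hk3
  · refine A.isUnitIntervalGraph_of_two_cover hA hprop hchordal (u := f 0) (v := f 1) ?_
    rw [Set.eq_univ_iff_forall]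
    intro α
    obtain ⟨i, hi⟩ := hcover α
    have : i = 0 ∨ i = 1 := by
      interval_cases k
      · exact Or.inl (Subsingleton.elim _ _)
      · exact (by decide : ∀ i : ZMod 2, i = 0 ∨ i = 1) i
    rcases this with rfl | rfl
    · exact Or.inl hi
    · exact Or.inr hi
  rcases hk3.eq_or_lt with rfl | hk4
  · exfalso
    obtain ⟨α, hα⟩ := hhelly (Set.range f) (by
      rintro _ ⟨i, rfl⟩ _ ⟨j, rfl⟩
      have : j = i ∨ j = i + 1 ∨ i = j + 1 := by revert i j; decide
      rcases this with rfl | rfl | rfl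
      · simpa using (A.isConnected_arc _).nonempty
      · exact hsucc i
      · rw [Set.inter_comm]; exact hsucc j)
    simp only [Set.mem_iInter, Set.forall_mem_range] at hα
    obtain ⟨j, hj⟩ := hlocα α
    have := hj (j + 2) (hα _)
    revert this
    clear hj
    revert j
    decide
  · refine absurd ⟨k, f, hk4, hfinj, fun i j => ?_⟩ hchordal
    have : Fact (1 < k) := ⟨by omega⟩
    by_cases hij : i = j
    · subst hij
      simp
    rw [hA.2 _ _ (hfinj.ne hij)]
    constructor
    · rintro ⟨α, hi, hj⟩
      obtain ⟨m, hm⟩ := hlocα α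
      rcases hm i hi with rfl | rfl <;> rcases hm j hj with rfl | rfl <;> simp_all
    · rintro (rfl | rfl)
      · rw [Set.inter_comm]; exact hsucc j
      · exact hsucc i
end
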